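/- arXiv:0706.2707 — 3 statements merged into one kernel-verified Lean document; each statement's English description precedes it below -/
import Mathlib

section
/- For every n ≥ 1 and every prime p, the dimension of G(n,p) over F_p equals g(n,p), the number of conjugacy classes of p-regular elements of the symmetric group S_n. -/
open scoped Classical

set_option synthInstance.maxHeartbeats 1000000
set_option maxHeartbeats 1000000

noncomputable section

/-- The group algebra `F_p[S_n]`. -/
abbrev GroupAlg (n p : ℕ) : Type := MonoidAlgebra (ZMod p) (Equiv.Perm (Fin n))

/-- The descent set of a permutation `σ` of `{1,…,n}` (1-based positions):
`k ∈ {1,…,n-1}` is a descent if `σ(k) > σ(k+1)`.  (With 0-based `Fin n` indices this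
compares the images at indices `k-1` and `k`.) -/
def descSet {n : ℕ} (σ : Equiv.Perm (Fin n)) : Set ℕ :=
  {k | ∃ h : k < n, 0 < k ∧ σ ⟨k, h⟩ < σ ⟨k - 1, by omega⟩}

/-- The set of proper partial sums `{a_1, a_1+a_2, …, a_1+⋯+a_{s-1}}` of a composition. -/
def properPartialSums {n : ℕ} (q : Composition n) : Set ℕ :=
  {m | ∃ i : ℕ, 0 < i ∧ i < q.length ∧ m = q.sizeUpTo i}

/-- `B̄_q`: the sum of all permutations whose descent set is contained in the set of
proper partial sums of `q`. -/
def Bel (n p : ℕ) (q : Composition n) : GroupAlg n p :=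
  ∑ σ ∈ Finset.univ.filter
      (fun σ : Equiv.Perm (Fin n) => descSet σ ⊆ properPartialSums q),
    MonoidAlgebra.of (ZMod p) (Equiv.Perm (Fin n)) σ

/-- The p-modular descent algebra `Σ(n,p)`, as a subalgebra of the group algebra. -/
def descentAlgebra (n p : ℕ) : Subalgebra (ZMod p) (GroupAlg n p) :=
  Algebra.adjoin (ZMod p) (Set.range (Bel n p))

/-- `B̄_q` as an element of `Σ(n,p)`. -/
def BelS (n p : ℕ) (q : Composition n) : descentAlgebra n p :=
  ⟨Bel n p q, Algebra.subset_adjoin ⟨q, rfl⟩⟩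

/-- The Jacobson radical `R(n,p)` of `Σ(n,p)`. -/
def descentRadical (n p : ℕ) : Ideal (descentAlgebra n p) :=
  (⊥ : Ideal (descentAlgebra n p)).jacobson

/-- `R(n,p)` viewed as an `F_p`-subspace of the group algebra. -/
def descentRadicalSubmodule (n p : ℕ) : Submodule (ZMod p) (GroupAlg n p) :=
  Submodule.map (descentAlgebra n p).val.toLinearMap
    ((descentRadical n p).restrictScalars (ZMod p))

/-- `Y_m`: the span of the `B̄_q` with `q` having at least `m` components. -/
def Ysub (n p m : ℕ) : Submodule (ZMod p) (GroupAlg n p) :=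
  Submodule.span (ZMod p) {x | ∃ q : Composition n, m ≤ q.length ∧ x = Bel n p q}

/-- `T`: the span of all differences `B̄_q - B̄_r` with `q ≈ r`. -/
def Tsub (n p : ℕ) : Submodule (ZMod p) (GroupAlg n p) :=
  Submodule.span (ZMod p)
    {x | ∃ q r : Composition n, q.blocks.Perm r.blocks ∧ x = Bel n p q - Bel n p r}

/-- `g(n,p)`: the number of partitions of `n` with no part divisible by `p`. -/
def gPart (n p : ℕ) : ℕ := Set.ncard {π : n.Partition | ∀ i ∈ π.parts, ¬ p ∣ i}

/-- `g(n,p)`: the number of conjugacy classes of `p`-regular elements of `S_n`. -/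
def gReg (n p : ℕ) : ℕ :=
  Set.ncard {c : ConjClasses (Equiv.Perm (Fin n)) | ∀ σ ∈ c.carrier, (orderOf σ).Coprime p}

/-- The Young character `χ_q`: `χ_q(σ)` is the number of ordered set partitions
`(P_1,…,P_s)` of `{1,…,n}` with `|P_i| = a_i`, each of whose blocks is `σ`-invariant. -/
def youngChar {n : ℕ} (q : Composition n) (σ : Equiv.Perm (Fin n)) : ℕ :=
  (Finset.univ.filter (fun P : Fin q.length → Finset (Fin n) =>
    (∀ i, (P i).card = q.blocksFun i) ∧
    (∀ i j, i ≠ j → Disjoint (P i) (P j)) ∧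
    (∀ x, ∃ i, x ∈ P i) ∧
    (∀ i, ∀ x ∈ P i, σ x ∈ P i))).card

/-- `χ̃_q`: the Young character with values reduced mod `p`. -/
def youngCharMod (n p : ℕ) (q : Composition n) : Equiv.Perm (Fin n) → ZMod p :=
  fun σ => (youngChar q σ : ZMod p)

/-- `G(n,p)`: the span of the mod-`p` Young characters. -/
def Gnp (n p : ℕ) : Submodule (ZMod p) (Equiv.Perm (Fin n) → ZMod p) :=
  Submodule.span (ZMod p) (Set.range (youngCharMod n p))

/-- `S(q,r)`: matrices with row sums `q` and column sums `r`. -/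
def SMat {n : ℕ} (q r : Composition n) : Set (Matrix (Fin q.length) (Fin r.length) ℕ) :=
  {Z | (∀ i, ∑ j, Z i j = q.blocksFun i) ∧ (∀ j, ∑ i, Z i j = r.blocksFun j)}

/-- `w(Z)`: the list of nonzero entries of `Z` read row by row. -/
def wList {s t : ℕ} (Z : Matrix (Fin s) (Fin t) ℕ) : List ℕ :=
  ((List.finRange s).flatMap fun i => ((List.finRange t).map fun j => Z i j)).filter
    (fun x => x ≠ 0)

/-- One merging step: replace two adjacent components by their sum. -/
def mergeStep (l l' : List ℕ) : Prop :=
  ∃ (u v : List ℕ) (a b : ℕ), l = u ++ a :: b :: v ∧ l' = u ++ (a + b) :: v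

/-- `coarsens l l'` (`l ⪯ l'` on compositions): `l'` is obtained from `l` by repeatedly
replacing adjacent components by their sum. -/
def coarsens (l l' : List ℕ) : Prop := Relation.ReflTransGen mergeStep l l'

/-- Ordered set partitions as colourings: `χ_q(σ)` counts the `σ`-invariant colourings whose
`i`-th colour is used `q_i` times. -/
theorem youngChar_eq_card_colorings {n : ℕ} (q : Composition n) (σ : Equiv.Perm (Fin n)) :
    youngChar q σ = (Finset.univ.filter (fun c : Fin n → Fin q.length =>
      (∀ i, (Finset.univ.filter (fun x => c x = i)).card = q.blocksFun i) ∧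
      ∀ x, c (σ x) = c x)).card := by
  symm
  unfold youngChar
  refine Finset.card_bij (fun c _ i => Finset.univ.filter (fun x => c x = i)) ?_ ?_ ?_
  · intro c hc
    simp only [Finset.mem_filter, Finset.mem_univ, true_and] at hc ⊢
    refine ⟨hc.1, fun i j hij => ?_, fun x => ⟨_, rfl⟩, fun i x hx => (hc.2 x).trans hx⟩
    rw [Finset.disjoint_left]
    intro x hx hx'
    simp only [Finset.mem_filter, Finset.mem_univ, true_and] at hx hx'
    exact hij (hx.symm.trans hx')
  · intro c _ c' _ h
    funext x
    have hx : x ∈ Finset.univ.filter (fun y => c' y = c x) := by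
      rw [← congrFun h (c x)]
      simp
    exact (Finset.mem_filter.1 hx).2.symm
  · intro P hP
    simp only [Finset.mem_filter, Finset.mem_univ, true_and] at hP
    obtain ⟨hcard, hdisj, hcov, hinv⟩ := hP
    choose c hc using hcov
    have huniq : ∀ x i, x ∈ P i → c x = i := fun x i hx => by
      by_contra h
      exact Finset.disjoint_left.1 (hdisj _ _ h) (hc x) hx
    have hfib : ∀ i, Finset.univ.filter (fun x => c x = i) = P i := fun i => by
      ext x
      simp only [Finset.mem_filter, Finset.mem_univ, true_and]
      exact ⟨fun h => h ▸ hc x, huniq x i⟩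
    refine ⟨c, ?_, funext hfib⟩
    simp only [Finset.mem_filter, Finset.mem_univ, true_and]
    exact ⟨fun i => by rw [hfib, hcard], fun x => huniq _ _ (hinv _ _ (hc x))⟩

theorem youngChar_conj {n : ℕ} (q : Composition n) {σ τ : Equiv.Perm (Fin n)} (h : IsConj σ τ) :
    youngChar q σ = youngChar q τ := by
  obtain ⟨π, rfl⟩ := isConj_iff.1 h
  rw [youngChar_eq_card_colorings, youngChar_eq_card_colorings]
  have hfib : ∀ (ρ : Equiv.Perm (Fin n)) (c : Fin n → Fin q.length) (i : Fin q.length),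
      (Finset.univ.filter (fun x => c (ρ x) = i)).card =
        (Finset.univ.filter (fun x => c x = i)).card := fun ρ c i =>
    Finset.card_bij (fun x _ => ρ x) (by simp) (by simp)
      (fun y hy => ⟨ρ.symm y, by simpa using hy, by simp⟩)
  refine Finset.card_bij (fun c _ x => c (π⁻¹ x)) ?_ ?_ ?_
  · intro c hc
    simp only [Finset.mem_filter, Finset.mem_univ, true_and] at hc ⊢
    refine ⟨fun i => (hfib π⁻¹ c i).trans (hc.1 i), fun x => ?_⟩
    simp [hc.2]
  · intro c _ c' _ hcc
    funext x
    simpa using congrFun hcc (π x)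
  · intro c hc
    simp only [Finset.mem_filter, Finset.mem_univ, true_and] at hc
    refine ⟨fun x => c (π x), ?_, by simp⟩
    simp only [Finset.mem_filter, Finset.mem_univ, true_and]
    refine ⟨fun i => (hfib π c i).trans (hc.1 i), fun x => ?_⟩
    simpa using hc.2 (π x)

/-- Young characters do not see `p`-power powers modulo `p`. -/
theorem youngChar_pow_prime_pow_modEq {n p : ℕ} (hp : p.Prime) (q : Composition n)
    (σ : Equiv.Perm (Fin n)) (a : ℕ) :
    youngChar q (σ ^ p ^ a) ≡ youngChar q σ [MOD p] := by
  have : Fact p.Prime := ⟨hp⟩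
  let balanced : (Fin n → Fin q.length) → Prop := fun c =>
    ∀ i, (Finset.univ.filter (fun x => c x = i)).card = q.blocksFun i
  let X := {c : Fin n → Fin q.length // balanced c ∧ ∀ x, c ((σ ^ p ^ a) x) = c x}
  have hbal : ∀ c, balanced c → balanced (fun x => c (σ x)) := fun c hc i => by
    rw [← hc i]
    exact Finset.card_bij (fun x _ => σ x) (by simp) (by simp)
      (fun y hy => ⟨σ.symm y, by simpa using hy, by simp⟩)
  let f : Function.End X := fun c => ⟨fun x => c.1 (σ x), hbal _ c.2.1, fun x => by
    have := c.2.2 (σ x)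
    rwa [← Equiv.Perm.mul_apply, ← pow_succ, pow_succ', Equiv.Perm.mul_apply] at this⟩
  have hpow : ∀ (k : ℕ) (c : X) (x : Fin n), ((f ^ k) c).1 x = c.1 ((σ ^ k) x) := by
    intro k
    induction k with
    | zero => intro c x; rfl
    | succ k ih =>
      intro c x
      rw [pow_succ, pow_succ']
      change ((f ^ k) (f c)).1 x = _
      rw [ih]
      rfl
  have hf : f ^ p ^ a = 1 := by
    funext c
    refine Subtype.ext (funext fun x => ?_)
    rw [hpow]
    exact c.2.2 x
  have hmod := Equiv.Perm.card_fixedPoints_modEq hf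
  have h₁ : Fintype.card X = youngChar q (σ ^ p ^ a) := by
    rw [youngChar_eq_card_colorings, ← Fintype.card_subtype]
  have hinv : ∀ c : Fin n → Fin q.length, (∀ x, c (σ x) = c x) →
      ∀ (k : ℕ) (x : Fin n), c ((σ ^ k) x) = c x := by
    intro c hc k
    induction k with
    | zero => intro x; rfl
    | succ k ih => intro x; rw [pow_succ, Equiv.Perm.mul_apply, ih, hc]
  have h₂ : Fintype.card (Function.fixedPoints f) = youngChar q σ := by
    rw [youngChar_eq_card_colorings, ← Fintype.card_subtype]
    refine Fintype.card_congr ⟨fun c => ⟨c.1.1, c.1.2.1, fun x => ?_⟩,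
      fun c => ⟨⟨c.1, c.2.1, hinv c.1 c.2.2 _⟩, ?_⟩, fun _ => rfl, fun _ => rfl⟩
    · exact congrFun (congrArg Subtype.val c.2) x
    · exact Subtype.ext (funext c.2.2)
  rwa [h₁, h₂] at hmod

/-- The functions in `G(n,p)` are class functions. -/
theorem Gnp_apply_conj {n p : ℕ} {f : Equiv.Perm (Fin n) → ZMod p} (hf : f ∈ Gnp n p)
    {σ τ : Equiv.Perm (Fin n)} (h : IsConj σ τ) : f σ = f τ := by
  induction hf using Submodule.span_induction with
  | mem x hx =>
    obtain ⟨q, rfl⟩ := hx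
    simp only [youngCharMod, youngChar_conj q h]
  | zero => rfl
  | add x y _ _ hx hy => simp [hx, hy]
  | smul a x _ hx => simp [hx]

theorem Gnp_apply_pow_prime_pow {n p : ℕ} (hp : p.Prime) {f : Equiv.Perm (Fin n) → ZMod p}
    (hf : f ∈ Gnp n p) (σ : Equiv.Perm (Fin n)) (a : ℕ) : f (σ ^ p ^ a) = f σ := by
  induction hf using Submodule.span_induction with
  | mem x hx =>
    obtain ⟨q, rfl⟩ := hx
    exact (ZMod.natCast_eq_natCast_iff _ _ _).2 (youngChar_pow_prime_pow_modEq hp q σ a)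
  | zero => rfl
  | add x y _ _ hx hy => simp [hx, hy]
  | smul a x _ hx => simp [hx]

/-- Some `p`-power power of a finite-order element is `p`-regular. -/
theorem exists_coprime_orderOf_pow_prime_pow {G : Type*} [Group G] [Finite G] {p : ℕ}
    (hp : p.Prime) (g : G) : ∃ a : ℕ, (orderOf (g ^ p ^ a)).Coprime p := by
  obtain ⟨a, m, hm, h⟩ := Nat.exists_eq_pow_mul_and_not_dvd (orderOf_pos g).ne' p hp.ne_one
  refine ⟨a, ?_⟩
  have : orderOf (g ^ p ^ a) = m := by
    rw [orderOf_pow_of_dvd (pow_ne_zero _ hp.ne_zero) (h ▸ dvd_mul_right _ _), h,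
      Nat.mul_div_cancel_left _ (pow_pos hp.pos _)]
  rw [this, Nat.coprime_comm]
  exact (Nat.Prime.coprime_iff_not_dvd hp).2 hm

theorem finrank_Gnp_le_gReg {n p : ℕ} (hp : p.Prime) :
    Module.finrank (ZMod p) (Gnp n p) ≤ gReg n p := by
  have : Fact p.Prime := ⟨hp⟩
  let R := {c : ConjClasses (Equiv.Perm (Fin n)) | ∀ σ ∈ c.carrier, (orderOf σ).Coprime p}
  let φ : Gnp n p →ₗ[ZMod p] (R → ZMod p) :=
    { toFun := fun f c => f.1 c.1.out
      map_add' := fun _ _ => rfl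
      map_smul' := fun _ _ => rfl }
  have hφ : Function.Injective φ := by
    rw [injective_iff_map_eq_zero]
    intro f hf
    refine Subtype.ext (funext fun σ => ?_)
    obtain ⟨a, ha⟩ := exists_coprime_orderOf_pow_prime_pow hp σ
    let c : R := ⟨ConjClasses.mk (σ ^ p ^ a), fun τ hτ => by
      obtain ⟨π, hπ⟩ := isConj_iff.1 (ConjClasses.mk_eq_mk_iff_isConj.1
        (ConjClasses.mem_carrier_iff_mk_eq.1 hτ))
      rw [← hπ] at ha
      simpa [← MulAut.conj_apply] using ha⟩
    have h₁ : IsConj (c.1.out) (σ ^ p ^ a) :=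
      ConjClasses.mk_eq_mk_iff_isConj.1 (Quotient.out_eq c.1)
    rw [← Gnp_apply_pow_prime_pow hp f.2 σ a, ← Gnp_apply_conj f.2 h₁]
    exact congrFun hf c
  calc Module.finrank (ZMod p) (Gnp n p) ≤ Module.finrank (ZMod p) (R → ZMod p) :=
        LinearMap.finrank_le_finrank_of_injective hφ
    _ = gReg n p := by
        rw [Module.finrank_fintype_fun_eq_card, ← Nat.card_eq_fintype_card]
        rfl

theorem gReg_le_card_countRestricted {n p : ℕ} (hp : p.Prime) :
    gReg n p ≤ (Nat.Partition.countRestricted n p).card := by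
  rw [← Nat.Partition.card_restricted_eq_card_countRestricted n hp.pos]
  suffices h : gReg n p ≤
      (Nat.Partition.restricted (Fintype.card (Fin n)) (fun i => ¬ p ∣ i)).card by
    have hn : Fintype.card (Fin n) = n := Fintype.card_fin n
    rw [hn] at h
    convert h
  unfold gReg
  rw [← Set.ncard_coe_finset]
  refine Set.ncard_le_ncard_of_injOn (fun c => c.out.partition) ?_ ?_ (Finset.finite_toSet _)
  · intro c hc
    have hc' : (orderOf c.out).Coprime p :=
      hc _ (ConjClasses.mem_carrier_iff_mk_eq.2 (Quotient.out_eq c))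
    simp only [Nat.Partition.restricted, Finset.coe_filter, Finset.mem_univ, true_and,
      Set.mem_ofPred_eq, Equiv.Perm.parts_partition, Multiset.mem_add]
    rintro i (hi | hi) hpi
    · have := Nat.Coprime.eq_one_of_dvd (Nat.Coprime.symm hc')
        (hpi.trans (Equiv.Perm.dvd_of_mem_cycleType hi))
      exact hp.ne_one this
    · rw [Multiset.eq_of_mem_replicate hi] at hpi
      exact hp.ne_one (Nat.dvd_one.1 hpi)
  · intro c _ d _ hcd
    have h : IsConj c.out d.out := by
      rw [Equiv.Perm.partition_eq_of_isConj]
      convert hcd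
    have h' := ConjClasses.mk_eq_mk_iff_isConj.2 h
    calc c = ConjClasses.mk c.out := (Quotient.out_eq c).symm
      _ = ConjClasses.mk d.out := h'
      _ = d := Quotient.out_eq d

/-- A function on `Fin k` invariant under `finRotate` is constant. -/
theorem eq_of_comp_finRotate {k : ℕ} {α : Type*} (g : Fin k → α)
    (hg : ∀ j, g (finRotate k j) = g j) (i j : Fin k) : g i = g j := by
  cases k with
  | zero => exact i.elim0
  | succ k =>
    have h : ∀ i : Fin (k + 1), g i = g 0 := by
      intro i
      induction i using Fin.induction with
      | zero => rfl
      | succ i ih =>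
        rw [← ih, ← hg i.castSucc, finRotate_apply, Fin.coeSucc_eq_succ]
    rw [h i, h j]

/-- A permutation whose cycles are the blocks of the composition `q`. -/
def blockRotation {n : ℕ} (q : Composition n) : Equiv.Perm (Fin n) :=
  q.blocksFinEquiv.permCongr (Equiv.Perm.sigmaCongrRight fun i => finRotate (q.blocksFun i))

theorem blockRotation_apply {n : ℕ} (q : Composition n)
    (x : Σ i : Fin q.length, Fin (q.blocksFun i)) :
    blockRotation q (q.blocksFinEquiv x) =
      q.blocksFinEquiv ⟨x.1, finRotate (q.blocksFun x.1) x.2⟩ := by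
  simp [blockRotation, Equiv.permCongr_apply, Equiv.Perm.sigmaCongrRight]

/-- `χ_r` at a permutation of cycle type `q` counts the ways to distribute the parts of `q`
into bins of capacities given by `r`. -/
theorem youngChar_blockRotation {n : ℕ} (r q : Composition n) :
    youngChar r (blockRotation q) =
      (Finset.univ.filter (fun d : Fin q.length → Fin r.length =>
        ∀ k, ∑ i ∈ Finset.univ.filter (fun i => d i = k), q.blocksFun i = r.blocksFun k)).card := by
  rw [youngChar_eq_card_colorings]
  symm
  have hfib : ∀ (d : Fin q.length → Fin r.length) (k : Fin r.length),
      (Finset.univ.filter (fun x => d (q.blocksFinEquiv.symm x).1 = k)).card =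
        ∑ i ∈ Finset.univ.filter (fun i => d i = k), q.blocksFun i := by
    intro d k
    rw [Finset.card_filter, ← q.blocksFinEquiv.sum_comp, ← Finset.univ_sigma_univ,
      Finset.sum_sigma, Finset.sum_filter]
    simp
  refine Finset.card_bij (fun d _ x => d (q.blocksFinEquiv.symm x).1) ?_ ?_ ?_
  · intro d hd
    simp only [Finset.mem_filter, Finset.mem_univ, true_and] at hd ⊢
    refine ⟨fun k => (hfib d k).trans (hd k), fun x => ?_⟩
    obtain ⟨y, rfl⟩ := q.blocksFinEquiv.surjective x
    rw [blockRotation_apply]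
    simp
  · intro d _ d' _ h
    funext i
    simpa using congrFun h (q.blocksFinEquiv ⟨i, ⟨0, q.one_le_blocksFun i⟩⟩)
  · intro c hc
    simp only [Finset.mem_filter, Finset.mem_univ, true_and] at hc
    have hd : ∀ x, c (q.blocksFinEquiv
        ⟨(q.blocksFinEquiv.symm x).1, ⟨0, q.one_le_blocksFun _⟩⟩) = c x := by
      intro x
      obtain ⟨⟨i, j⟩, rfl⟩ := q.blocksFinEquiv.surjective x
      rw [Equiv.symm_apply_apply]
      refine eq_of_comp_finRotate (fun j => c (q.blocksFinEquiv ⟨i, j⟩)) (fun j => ?_) _ j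
      have := hc.2 (q.blocksFinEquiv ⟨i, j⟩)
      rwa [blockRotation_apply] at this
    refine ⟨fun i => c (q.blocksFinEquiv ⟨i, ⟨0, q.one_le_blocksFun i⟩⟩), ?_, funext hd⟩
    simp only [Finset.mem_filter, Finset.mem_univ, true_and]
    intro k
    rw [← hc.1 k, ← hfib]
    simp only [hd]

theorem surjective_of_sum_blocksFun_eq {n : ℕ} {r q : Composition n}
    {d : Fin q.length → Fin r.length}
    (hd : ∀ k, ∑ i ∈ Finset.univ.filter (fun i => d i = k), q.blocksFun i = r.blocksFun k) :
    Function.Surjective d := by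
  intro k
  by_contra! h
  have := hd k
  rw [Finset.filter_false_of_mem (fun i _ => h i), Finset.sum_empty] at this
  have := r.one_le_blocksFun k
  omega

theorem blocksFun_comp_of_bijective {n : ℕ} {r q : Composition n}
    {d : Fin q.length → Fin r.length} (hinj : Function.Injective d)
    (hd : ∀ k, ∑ i ∈ Finset.univ.filter (fun i => d i = k), q.blocksFun i = r.blocksFun k)
    (i : Fin q.length) : r.blocksFun (d i) = q.blocksFun i := by
  rw [← hd, Finset.filter_congr (q := fun j => j = i) (fun j _ => hinj.eq_iff),
    Finset.sum_filter, Finset.sum_eq_single i (fun j _ hj => if_neg hj) (by simp), if_pos rfl]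

theorem map_blocksFun_eq_blocks {n : ℕ} (q : Composition n) :
    Finset.univ.val.map q.blocksFun = (q.blocks : Multiset ℕ) := by
  rw [← q.ofFn_blocksFun, Fin.univ_val_map]

theorem length_lt_or_blocks_eq_of_youngChar_ne_zero {n : ℕ} {r q : Composition n}
    (h : youngChar r (blockRotation q) ≠ 0) :
    r.length < q.length ∨ (r.blocks : Multiset ℕ) = q.blocks := by
  rw [youngChar_blockRotation, Finset.card_ne_zero] at h
  obtain ⟨d, hd⟩ := h
  simp only [Finset.mem_filter, Finset.mem_univ, true_and] at hd
  have hsurj := surjective_of_sum_blocksFun_eq hd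
  have hle : r.length ≤ q.length := by simpa using Fintype.card_le_of_surjective d hsurj
  refine hle.lt_or_eq.imp_right fun heq => ?_
  have hbij : Function.Bijective d :=
    (Fintype.bijective_iff_surjective_and_card d).2 ⟨hsurj, by simp [heq]⟩
  rw [← map_blocksFun_eq_blocks, ← map_blocksFun_eq_blocks]
  have := Multiset.map_univ_val_equiv (Equiv.ofBijective d hbij)
  rw [← this, Multiset.map_map]
  exact Multiset.map_congr rfl fun i _ => blocksFun_comp_of_bijective hbij.1 hd i

theorem not_dvd_youngChar_blockRotation_self {n p : ℕ} (hp : p.Prime) (q : Composition n)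
    (hq : ∀ i, q.blocks.count i < p) : ¬ p ∣ youngChar q (blockRotation q) := by
  have hcard : youngChar q (blockRotation q) =
      Fintype.card {g : Equiv.Perm (Fin q.length) // q.blocksFun ∘ g = q.blocksFun} := by
    rw [youngChar_blockRotation, Fintype.card_subtype]
    symm
    refine Finset.card_bij (fun g _ => g) ?_ (fun g _ g' _ h => DFunLike.coe_injective h) ?_
    · intro g hg
      simp only [Finset.mem_filter, Finset.mem_univ, true_and] at hg ⊢
      intro k
      have hk := congrFun hg (g.symm k)
      rw [Function.comp_apply, Equiv.apply_symm_apply] at hk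
      rw [hk, Finset.sum_filter, Finset.sum_eq_single (g.symm k), if_pos (g.apply_symm_apply k)]
      · exact fun i _ hi => if_neg fun h => hi ((Equiv.eq_symm_apply g).2 h)
      · simp
    · intro d hd
      simp only [Finset.mem_filter, Finset.mem_univ, true_and] at hd
      have hbij := Finite.surjective_iff_bijective.1 (surjective_of_sum_blocksFun_eq hd)
      refine ⟨Equiv.ofBijective d hbij, ?_, rfl⟩
      simp only [Finset.mem_filter, Finset.mem_univ, true_and]
      exact funext fun i => blocksFun_comp_of_bijective hbij.1 hd i
  have hstab := DomMulAct.stabilizer_card' q.blocksFun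
  rw [hcard]
  intro hdvd
  have hdvd' : p ∣ ∏ i ∈ Finset.univ.image q.blocksFun,
      (Fintype.card {a // q.blocksFun a = i}).factorial := by
    rw [← hstab]
    convert hdvd
  obtain ⟨i, _, hi⟩ := (Prime.dvd_finsetProd_iff hp.prime _).1 hdvd'
  rw [hp.dvd_factorial] at hi
  refine absurd (hq i) (not_lt.2 (hi.trans (le_of_eq ?_)))
  rw [← Multiset.coe_count, ← map_blocksFun_eq_blocks, Multiset.count_map, Fintype.card_subtype,
    Finset.card_def, Finset.filter_val]
  simp only [eq_comm]

/-- A composition listing the parts of a partition. -/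
def partitionComposition {n : ℕ} (π : n.Partition) : Composition n where
  blocks := π.parts.toList
  blocks_pos := fun h => π.parts_pos (Multiset.mem_toList.1 h)
  blocks_sum := by rw [Multiset.sum_toList, π.parts_sum]

theorem coe_blocks_partitionComposition {n : ℕ} (π : n.Partition) :
    ((partitionComposition π).blocks : Multiset ℕ) = π.parts :=
  Multiset.coe_toList _

theorem count_blocks_partitionComposition_lt {n p : ℕ} (hp : p.Prime) {π : n.Partition}
    (hπ : π ∈ Nat.Partition.countRestricted n p) (i : ℕ) :
    (partitionComposition π).blocks.count i < p := by
  rw [← Multiset.coe_count, coe_blocks_partitionComposition]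
  by_cases hi : i ∈ π.parts
  · exact (Finset.mem_filter.1 hπ).2 i hi
  · rw [Multiset.count_eq_zero_of_notMem hi]
    exact hp.pos

/-- A family of functions that is triangular with respect to a ranking and has nonzero diagonal
is linearly independent. -/
theorem linearIndependent_of_triangular {ι X K : Type*} [Field K]
    (v : ι → X → K) (x : ι → X) (rank : ι → ℕ) (hdiag : ∀ i, v i (x i) ≠ 0)
    (htri : ∀ i j, v i (x j) ≠ 0 → rank i < rank j ∨ i = j) : LinearIndependent K v := by
  rw [linearIndependent_iff']
  intro s a hsum
  by_contra! h
  obtain ⟨i₀, hi₀, hne₀⟩ := h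
  obtain ⟨j, hj, hmin⟩ := Finset.exists_min_image (s.filter fun i => a i ≠ 0) rank
    ⟨i₀, Finset.mem_filter.2 ⟨hi₀, hne₀⟩⟩
  rw [Finset.mem_filter] at hj
  have hval := congrFun hsum (x j)
  rw [Finset.sum_apply, Finset.sum_eq_single j] at hval
  · exact (mul_ne_zero hj.2 (hdiag j)) hval
  · intro i hi hij
    by_contra hne
    have hai : a i ≠ 0 := fun h0 => hne (by simp [h0])
    have hvi : v i (x j) ≠ 0 := fun h0 => hne (by simp [h0])
    rcases htri i j hvi with hlt | heq
    · exact absurd (hmin i (Finset.mem_filter.2 ⟨hi, hai⟩)) (not_le.2 hlt)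
    · exact hij heq
  · exact fun hj' => absurd hj.1 hj'

theorem card_countRestricted_le_finrank_Gnp {n p : ℕ} (hp : p.Prime) :
    (Nat.Partition.countRestricted n p).card ≤ Module.finrank (ZMod p) (Gnp n p) := by
  have : Fact p.Prime := ⟨hp⟩
  let v : Nat.Partition.countRestricted n p → Gnp n p := fun π =>
    ⟨youngCharMod n p (partitionComposition π.1), Submodule.subset_span ⟨_, rfl⟩⟩
  have hli : LinearIndependent (ZMod p)
      (fun π : Nat.Partition.countRestricted n p =>
        youngCharMod n p (partitionComposition π.1)) := by
    refine linearIndependent_of_triangular _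
      (fun π => blockRotation (partitionComposition π.1))
      (fun π => (partitionComposition π.1).length) ?_ ?_
    · intro π h
      exact not_dvd_youngChar_blockRotation_self hp _
        (count_blocks_partitionComposition_lt hp π.2) ((ZMod.natCast_eq_zero_iff _ _).1 h)
    · intro π ρ h
      refine (length_lt_or_blocks_eq_of_youngChar_ne_zero
        fun h0 => h (by simp [youngCharMod, h0])).imp_right fun heq => ?_
      rw [coe_blocks_partitionComposition, coe_blocks_partitionComposition] at heq
      exact Subtype.ext (Nat.Partition.ext heq)
  have hv : LinearIndependent (ZMod p) v :=
    LinearIndependent.of_comp (Gnp n p).subtype hli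
  simpa using hv.fintype_card_le_finrank

/-- For every `n ≥ 1` and every prime `p`, the dimension of `G(n,p)` over
`F_p` equals `g(n,p)`, the number of conjugacy classes of `p`-regular elements of `S_n`. -/
theorem stmt3 (n p : ℕ) (hn : 1 ≤ n) (hp : p.Prime) :
    Module.finrank (ZMod p) (Gnp n p) = gReg n p := by
  exact le_antisymm (finrank_Gnp_le_gReg hp)
    ((gReg_le_card_countRestricted hp).trans (card_countRestricted_le_finrank_Gnp hp))

end
end

section
/- Let r be a composition of n. The basis element B̄_r of Σ(n,p) is nilpotent if and only if some value occurs among the components of r with multiplicity p or more. -/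
open scoped Classical

set_option synthInstance.maxHeartbeats 1000000
set_option maxHeartbeats 1000000

noncomputable section

/-- The permutations that are increasing on every class of the equivalence relation `S`. -/
def increasingOn {n : ℕ} (S : Setoid (Fin n)) : Finset (Equiv.Perm (Fin n)) :=
  Finset.univ.filter fun σ => ∀ i j, i < j → S i j → σ i < σ j

/-- The sum in the group algebra of the permutations increasing on every class of `S`. -/
def increasingSum {n : ℕ} (p : ℕ) (S : Setoid (Fin n)) : GroupAlg n p :=
  ∑ σ ∈ increasingOn S, MonoidAlgebra.of (ZMod p) (Equiv.Perm (Fin n)) σ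

/-- The rearrangements of `b` that are weakly increasing on every class of `S`. -/
def monotoneRearrangements {n s : ℕ} (b : Fin n → Fin s) (S : Setoid (Fin n)) :
    Finset (Fin n → Fin s) :=
  Finset.univ.filter fun h =>
    (∃ π : Equiv.Perm (Fin n), h = b ∘ π) ∧ ∀ i j, i < j → S i j → h i ≤ h j

theorem mem_increasingOn {n : ℕ} {S : Setoid (Fin n)} {σ : Equiv.Perm (Fin n)} :
    σ ∈ increasingOn S ↔ ∀ i j, i < j → S i j → σ i < σ j := by
  simp [increasingOn]

theorem mem_monotoneRearrangements {n s : ℕ} {b : Fin n → Fin s} {S : Setoid (Fin n)}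
    {h : Fin n → Fin s} :
    h ∈ monotoneRearrangements b S ↔
      (∃ π : Equiv.Perm (Fin n), h = b ∘ π) ∧ ∀ i j, i < j → S i j → h i ≤ h j := by
  simp [monotoneRearrangements]

theorem comp_sort_of_rearrangement {n s : ℕ} {b : Fin n → Fin s} (hb : Monotone b)
    {c : Fin n → Fin s} {π : Equiv.Perm (Fin n)} (hc : c = b ∘ π) :
    c ∘ Tuple.sort c = b := by
  have h1 : c ∘ (π⁻¹ : Equiv.Perm (Fin n)) = b := by
    subst hc; ext x; simp
  rw [← h1]
  exact Tuple.unique_monotone (Tuple.monotone_sort c) (by rw [h1]; exact hb)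

theorem increasingSum_ker_mul {n s : ℕ} (p : ℕ) {b : Fin n → Fin s} (hb : Monotone b)
    (S : Setoid (Fin n)) :
    increasingSum p (Setoid.ker b) * increasingSum p S =
      ∑ h ∈ monotoneRearrangements b S, increasingSum p (S ⊓ Setoid.ker h) := by
  unfold increasingSum
  rw [Finset.sum_mul_sum, ← Finset.sum_product', Finset.sum_sigma']
  have sort_mem : ∀ {c : Fin n → Fin s} {π : Equiv.Perm (Fin n)}, c = b ∘ π →
      ∀ i j, i < j → b i = b j → Tuple.sort c i < Tuple.sort c j := by
    intro c π hc i j hij hbij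
    have h1 := congrFun (comp_sort_of_rearrangement hb hc)
    refine (Tuple.eq_sort_iff.1 (rfl : Tuple.sort c = Tuple.sort c)).2 i j hij ?_
    have hi := h1 i
    have hj := h1 j
    simp only [Function.comp_apply] at hi hj
    rw [hi, hj, hbij]
  refine Finset.sum_nbij' (fun x => ⟨b ∘ x.2, x.1 * x.2⟩)
    (fun y => (Tuple.sort (y.1 ∘ (y.2⁻¹ : Equiv.Perm (Fin n))),
      (Tuple.sort (y.1 ∘ (y.2⁻¹ : Equiv.Perm (Fin n))))⁻¹ * y.2)) ?_ ?_ ?_ ?_ ?_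
  · rintro ⟨σ, τ⟩ h
    simp only [Finset.mem_product, mem_increasingOn, Setoid.ker_def] at h
    simp only [Finset.mem_sigma, mem_increasingOn, mem_monotoneRearrangements]
    refine ⟨⟨⟨τ, rfl⟩, fun i j hij hS => hb (h.2 i j hij hS).le⟩, ?_⟩
    rintro i j hij ⟨hS, hk⟩
    exact h.1 _ _ (h.2 i j hij hS) hk
  · rintro ⟨h, ρ⟩ hm
    simp only [Finset.mem_sigma, mem_increasingOn, mem_monotoneRearrangements] at hm
    obtain ⟨⟨⟨π, hπ⟩, hmono⟩, hρ⟩ := hm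
    have hc : h ∘ (ρ⁻¹ : Equiv.Perm (Fin n)) = b ∘ (π * ρ⁻¹ : Equiv.Perm (Fin n)) := by
      subst hπ; rfl
    set σ := Tuple.sort (h ∘ (ρ⁻¹ : Equiv.Perm (Fin n))) with hσ
    have hσb := congrFun (comp_sort_of_rearrangement hb hc)
    rw [← hσ] at hσb
    have hbσ : ∀ i, b (σ⁻¹ (ρ i)) = h i := by
      intro i
      rw [← hσb]; simp
    simp only [Finset.mem_product, mem_increasingOn, Setoid.ker_def]
    refine ⟨sort_mem hc, fun i j hij hS => ?_⟩
    simp only [Equiv.Perm.coe_mul, Function.comp_apply]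
    rcases (hmono i j hij hS).lt_or_eq with hlt | heq
    · rw [← hbσ i, ← hbσ j] at hlt
      exact hb.reflect_lt hlt
    · by_contra hcon
      rcases (not_lt.1 hcon).lt_or_eq with hlt | he
      · have := sort_mem hc _ _ hlt (by rw [hbσ, hbσ, heq])
        rw [← hσ] at this
        simp only [← Equiv.Perm.mul_apply, mul_inv_cancel_left] at this
        exact absurd this (hρ i j hij ⟨hS, heq⟩).not_gt
      · exact hij.ne' (ρ.injective (σ⁻¹.injective he))
  · rintro ⟨σ, τ⟩ h
    simp only [Finset.mem_product, mem_increasingOn, Setoid.ker_def] at h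
    have hc : (b ∘ τ) ∘ ((σ * τ)⁻¹ : Equiv.Perm (Fin n)) = b ∘ (σ⁻¹ : Equiv.Perm (Fin n)) := by
      ext x; simp
    have : Tuple.sort ((b ∘ τ) ∘ ((σ * τ)⁻¹ : Equiv.Perm (Fin n))) = σ := by
      rw [hc]
      symm
      rw [Tuple.eq_sort_iff]
      refine ⟨?_, fun i j hij he => h.1 i j hij (by simpa using he)⟩
      intro i j hij
      simpa using hb hij
    simp only [this]
    simp
  · rintro ⟨h, ρ⟩ hm
    simp only [Finset.mem_sigma, mem_monotoneRearrangements] at hm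
    obtain ⟨⟨⟨π, hπ⟩, -⟩, -⟩ := hm
    have hc : h ∘ (ρ⁻¹ : Equiv.Perm (Fin n)) = b ∘ (π * ρ⁻¹ : Equiv.Perm (Fin n)) := by
      subst hπ; rfl
    have hσb := congrFun (comp_sort_of_rearrangement hb hc)
    set σ := Tuple.sort (h ∘ (ρ⁻¹ : Equiv.Perm (Fin n))) with hσ
    have h1 : b ∘ (σ⁻¹ * ρ : Equiv.Perm (Fin n)) = h := by
      ext i
      simp only [Equiv.Perm.coe_mul, Function.comp_apply]
      rw [← hσb]; simp
    have h2 : σ * (σ⁻¹ * ρ) = ρ := by group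
    simp only [h1, h2]
  · rintro ⟨σ, τ⟩ _
    simp

theorem exists_rearrangement_iff {n s : ℕ} {b h : Fin n → Fin s} :
    (∃ π : Equiv.Perm (Fin n), h = b ∘ π) ↔
      ∀ j, Fintype.card {i // h i = j} = Fintype.card {i // b i = j} := by
  constructor
  · rintro ⟨π, rfl⟩ j
    exact Fintype.card_congr (π.subtypeEquiv fun i => Iff.rfl)
  · intro hc
    let e := fun j => Fintype.equivOfCardEq (hc j)
    exact ⟨Equiv.ofFiberEquiv e, funext fun i => (Equiv.ofFiberEquiv_map e i).symm⟩

/-- The permutations of the values of `b` preserving the sizes of its fibres. -/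
abbrev FiberSymm {n s : ℕ} (b : Fin n → Fin s) : Type :=
  {g : Equiv.Perm (Fin s) //
    (fun j => Fintype.card {i // b i = j}) ∘ g = fun j => Fintype.card {i // b i = j}}

theorem exists_rearrangement_comp_iff {n s : ℕ} {b : Fin n → Fin s} (g : Equiv.Perm (Fin s)) :
    (∃ π : Equiv.Perm (Fin n), g ∘ b = b ∘ π) ↔
      (fun j => Fintype.card {i // b i = j}) ∘ g = fun j => Fintype.card {i // b i = j} := by
  have key : ∀ j, Fintype.card {i // (g ∘ b) i = g j} = Fintype.card {i // b i = j} := fun j =>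
    Fintype.card_congr (Equiv.subtypeEquivRight fun i => by simp)
  rw [exists_rearrangement_iff]
  constructor
  · intro h
    funext j
    rw [← key j, h (g j), Function.comp_apply]
  · intro h j
    obtain ⟨j, rfl⟩ := g.surjective j
    rw [key, ← congrFun h j, Function.comp_apply]

theorem card_filter_ker_le {n s : ℕ} {b : Fin n → Fin s} (hs : Function.Surjective b) :
    ((monotoneRearrangements b (Setoid.ker b)).filter
      fun h => Setoid.ker b ≤ Setoid.ker h).card = Fintype.card (FiberSymm b) := by
  rw [← Finset.card_univ]
  symm
  refine Finset.card_bij (fun g _ => g.1 ∘ b) ?_ ?_ ?_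
  · rintro ⟨g, hg⟩ -
    rw [Finset.mem_filter, mem_monotoneRearrangements]
    refine ⟨⟨(exists_rearrangement_comp_iff g).2 hg, fun i j _ h => ?_⟩, fun i j h => ?_⟩
    · exact le_of_eq (congrArg g (Setoid.ker_def.1 h))
    · exact congrArg g (Setoid.ker_def.1 h)
  · rintro g - g' - h
    exact Subtype.ext (Equiv.ext fun j => congrFun (hs.injective_comp_right h) j)
  · intro h hh
    rw [Finset.mem_filter, mem_monotoneRearrangements] at hh
    obtain ⟨⟨hr, -⟩, hk⟩ := hh
    have hfac : (h ∘ Function.surjInv hs) ∘ b = h := by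
      funext i
      exact hk (Setoid.ker_def.2 (Function.surjInv_eq hs (b i)))
    have hsurj : Function.Surjective h := by
      obtain ⟨π, rfl⟩ := hr
      exact hs.comp π.surjective
    have hγ : Function.Surjective (h ∘ Function.surjInv hs) := by
      rw [← hfac] at hsurj
      exact hsurj.of_comp
    let g := Equiv.ofBijective _ (Finite.surjective_iff_bijective.1 hγ)
    have hg : g ∘ b = h := hfac
    rw [← hg] at hr
    exact ⟨⟨g, (exists_rearrangement_comp_iff g).1 hr⟩, Finset.mem_univ _, hg⟩

theorem prime_dvd_card_filter_le_ker {n s p : ℕ} (hp : p.Prime) {b : Fin n → Fin s}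
    (hs : Function.Surjective b) (hd : p ∣ Fintype.card (FiberSymm b)) (S : Setoid (Fin n)) :
    p ∣ ((monotoneRearrangements b S).filter fun h => S ≤ Setoid.ker h).card := by
  have := Fact.mk hp
  let H : Subgroup (Equiv.Perm (Fin s)) :=
    { carrier := {g | (fun j => Fintype.card {i // b i = j}) ∘ g =
        fun j => Fintype.card {i // b i = j}}
      one_mem' := rfl
      mul_mem' := by
        intro g g' hg hg'
        rw [Set.mem_ofPred_eq] at *
        rw [Equiv.Perm.coe_mul, ← Function.comp_assoc, hg, hg']
      inv_mem' := by
        intro g hg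
        rw [Set.mem_ofPred_eq] at *
        conv_lhs => rw [← hg]
        funext j
        simp }
  have hd' : p ∣ Fintype.card H := by
    convert hd using 2
    simp only [H, FiberSymm]
    rfl
  obtain ⟨⟨g, hgH⟩, hord⟩ := exists_prime_orderOf_dvd_card p hd'
  have hord' : orderOf g = p := by
    rw [← hord, Subgroup.orderOf_mk]
  set X := (monotoneRearrangements b S).filter fun h => S ≤ Setoid.ker h with hX
  have hmem : ∀ h, h ∈ X ↔ (∃ π : Equiv.Perm (Fin n), h = b ∘ π) ∧ S ≤ Setoid.ker h := by
    intro h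
    rw [hX, Finset.mem_filter, mem_monotoneRearrangements]
    refine ⟨fun h => ⟨h.1.1, h.2⟩, fun h => ⟨⟨h.1, fun i j _ hS => ?_⟩, h.2⟩⟩
    exact le_of_eq (Setoid.ker_def.1 (h.2 hS))
  have hstab : ∀ h ∈ X, g ∘ h ∈ X := by
    intro h hh
    rw [hmem] at *
    obtain ⟨⟨π, rfl⟩, hk⟩ := hh
    obtain ⟨π', hπ'⟩ := (exists_rearrangement_comp_iff g).2 hgH
    refine ⟨⟨π' * π, ?_⟩, fun i j hS => ?_⟩
    · rw [← Function.comp_assoc, hπ']; rfl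
    · exact congrArg g (Setoid.ker_def.1 (hk hS))
  let f : Function.End X := fun h => ⟨g ∘ h.1, hstab _ h.2⟩
  have hf : ∀ (k : ℕ) (h : X), ((f ^ k) h).1 = (g ^ k : Equiv.Perm (Fin s)) ∘ h.1 := by
    intro k
    induction k with
    | zero => intro h; rfl
    | succ k ih =>
      intro h
      rw [pow_succ, pow_succ]
      change ((f ^ k) (f h)).1 = _
      rw [ih]
      rfl
  have hf1 : f ^ p ^ 1 = 1 := by
    funext h
    apply Subtype.ext
    rw [hf, pow_one, ← hord', pow_orderOf_eq_one]
    rfl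
  have hmod := Equiv.Perm.card_fixedPoints_modEq hf1
  have hempty : IsEmpty (Function.fixedPoints f) := by
    refine ⟨fun ⟨h, hh⟩ => ?_⟩
    have hfix : g ∘ h.1 = h.1 := congrArg Subtype.val hh
    obtain ⟨⟨π, hπ⟩, -⟩ := (hmem _).1 h.2
    have hsurj : Function.Surjective h.1 := by
      rw [hπ]; exact hs.comp π.surjective
    have hg1 : g = 1 := Equiv.ext fun j => by
      obtain ⟨i, rfl⟩ := hsurj j
      exact congrFun hfix i
    rw [hg1, orderOf_one] at hord'
    exact hp.one_lt.ne hord'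
  rw [Fintype.card_coe, @Fintype.card_eq_zero _ _ hempty] at hmod
  exact (Nat.modEq_zero_iff_dvd).1 hmod

theorem exists_pow_mul_increasingSum_eq_zero {n s p : ℕ} (hp : p.Prime) {b : Fin n → Fin s}
    (hb : Monotone b) (hs : Function.Surjective b) (hd : p ∣ Fintype.card (FiberSymm b))
    (S : Setoid (Fin n)) :
    ∃ k, increasingSum p (Setoid.ker b) ^ k * increasingSum p S = 0 := by
  let V := Module.End.maxGenEigenspace
    (LinearMap.mulLeft (ZMod p) (increasingSum p (Setoid.ker b))) 0
  have hV : ∀ x, x ∈ V ↔ ∃ k, increasingSum p (Setoid.ker b) ^ k * x = 0 := by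
    intro x
    simp only [V, Module.End.mem_maxGenEigenspace, zero_smul, sub_zero, LinearMap.pow_mulLeft,
      LinearMap.mulLeft_apply]
  have : Finite (Setoid (Fin n)) :=
    Finite.of_injective (fun S : Setoid (Fin n) => S.r) fun S S' h =>
      Setoid.ext fun i j => iff_of_eq (congrFun (congrFun h i) j)
  induction S using WellFoundedLT.induction with
  | ind S ih =>
    have hmem : increasingSum p (Setoid.ker b) * increasingSum p S ∈ V := by
      rw [increasingSum_ker_mul p hb,
        ← Finset.sum_filter_add_sum_filter_not _ (fun h => S ≤ Setoid.ker h)]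
      refine V.add_mem ?_ (V.sum_mem fun h hh => ?_)
      · rw [Finset.sum_congr rfl fun h hh => by
          rw [inf_eq_left.2 (Finset.mem_filter.1 hh).2], Finset.sum_const,
          ← Nat.cast_smul_eq_nsmul (ZMod p),
          (ZMod.natCast_eq_zero_iff _ _).2 (prime_dvd_card_filter_le_ker hp hs hd S), zero_smul]
        exact V.zero_mem
      · exact (hV _).2 (ih _ (inf_lt_left.2 (Finset.mem_filter.1 hh).2))
    obtain ⟨k, hk⟩ := (hV _).1 hmem
    exact ⟨k + 1, by rw [pow_succ, mul_assoc, hk]⟩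

theorem increasingSum_top {n : ℕ} (p : ℕ) : increasingSum p (⊤ : Setoid (Fin n)) = 1 := by
  have : increasingOn (⊤ : Setoid (Fin n)) = {1} := by
    ext σ
    rw [mem_increasingOn, Finset.mem_singleton]
    constructor
    · intro h
      have hm : StrictMono σ := fun i j hij => h i j hij trivial
      ext i
      have := Subsingleton.elim (hm.orderIsoOfSurjective σ σ.surjective) (OrderIso.refl _)
      exact congrArg Fin.val (DFunLike.congr_fun this i)
    · rintro rfl i j hij -
      exact hij
  rw [increasingSum, this, Finset.sum_singleton, map_one]

/-- The equivalence relation `S` has only intervals as classes. -/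
def HasIntervalClasses {n : ℕ} (S : Setoid (Fin n)) : Prop :=
  ∀ i j k, i ≤ j → j ≤ k → S i k → S i j

theorem HasIntervalClasses.inf_ker {n s : ℕ} {S : Setoid (Fin n)} (hS : HasIntervalClasses S)
    {h : Fin n → Fin s} (hh : ∀ i j, i < j → S i j → h i ≤ h j) :
    HasIntervalClasses (S ⊓ Setoid.ker h) := by
  rintro i j k hij hjk ⟨hik, he⟩
  have h1 := hS i j k hij hjk hik
  have h2 : S j k := S.trans (S.symm h1) hik
  refine ⟨h1, ?_⟩
  change h i = h k at he
  change h i = h j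
  rcases hij.eq_or_lt with rfl | hij
  · rfl
  rcases hjk.eq_or_lt with rfl | hjk
  · exact he
  exact le_antisymm (hh _ _ hij h1) ((hh _ _ hjk h2).trans he.ge)

/-- The positions at which a class of `S` ends and another one starts. -/
def cuts {n : ℕ} (S : Setoid (Fin n)) : Finset (Fin n) :=
  Finset.univ.filter fun k => ∃ h : 0 < (k : ℕ), ¬ S ⟨k - 1, by omega⟩ k

theorem mem_cuts {n : ℕ} {S : Setoid (Fin n)} {k : Fin n} :
    k ∈ cuts S ↔ ∃ h : 0 < (k : ℕ), ¬ S ⟨k - 1, by omega⟩ k := by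
  simp [cuts]

theorem HasIntervalClasses.rel_iff {n : ℕ} {S : Setoid (Fin n)} (hS : HasIntervalClasses S)
    {i j : Fin n} (hij : i ≤ j) : S i j ↔ ∀ k ∈ cuts S, i < k → ¬ k ≤ j := by
  constructor
  · intro h k hk hik hkj
    obtain ⟨hk0, hk⟩ := mem_cuts.1 hk
    have h1 : S i k := hS i k j hik.le hkj h
    have h2 : S i ⟨k - 1, by omega⟩ :=
      hS i _ k (Fin.mk_le_mk.2 (Nat.le_sub_one_of_lt hik)) (Fin.mk_le_mk.2 (Nat.sub_le _ _)) h1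
    exact hk (S.trans (S.symm h2) h1)
  · intro h
    obtain ⟨j, hj⟩ := j
    induction j with
    | zero =>
      have : i = ⟨0, hj⟩ := le_antisymm hij (Fin.mk_le_mk.2 (Nat.zero_le _))
      rw [this]
    | succ j ih =>
      rcases hij.eq_or_lt with rfl | hlt
      · exact S.refl _
      · have hlt' : i ≤ ⟨j, by omega⟩ := Fin.mk_le_mk.2 (Nat.le_of_lt_succ hlt)
        have h1 := ih (by omega) hlt' fun k hk hik hkj =>
          h k hk hik (hkj.trans (Fin.mk_le_mk.2 (Nat.le_succ _)))
        refine S.trans h1 ?_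
        by_contra hcon
        exact h ⟨j + 1, hj⟩ (mem_cuts.2 ⟨Nat.succ_pos _, hcon⟩) hlt le_rfl

theorem HasIntervalClasses.le_of_cuts_subset {n : ℕ} {S S' : Setoid (Fin n)}
    (hS : HasIntervalClasses S) (hS' : HasIntervalClasses S') (h : cuts S' ⊆ cuts S) :
    S ≤ S' := by
  have key : ∀ {i j}, i ≤ j → S i j → S' i j := fun hij hr =>
    (hS'.rel_iff hij).2 fun k hk => (hS.rel_iff hij).1 hr k (h hk)
  intro i j hr
  rcases le_total i j with hij | hij
  · exact key hij hr
  · exact S'.symm (key hij (S.symm hr))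

theorem cuts_anti {n : ℕ} {S S' : Setoid (Fin n)} (h : S ≤ S') : cuts S' ⊆ cuts S := by
  intro k hk
  obtain ⟨h0, hk⟩ := mem_cuts.1 hk
  exact mem_cuts.2 ⟨h0, fun hr => hk (h hr)⟩

/-- A permutation whose descents are the nonzero elements of `T`. -/
def permWithDescents {n : ℕ} (T : Finset (Fin n)) : Equiv.Perm (Fin n) :=
  (Tuple.sort fun i => OrderDual.toDual (T.filter fun t => t ≤ i).card)⁻¹

theorem permWithDescents_lt_iff {n : ℕ} {T : Finset (Fin n)} {i j : Fin n} (hij : i < j) :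
    permWithDescents T i < permWithDescents T j ↔ ∀ t ∈ T, i < t → ¬ t ≤ j := by
  set f : Fin n → ℕᵒᵈ := fun i => OrderDual.toDual (T.filter fun t => t ≤ i).card with hf
  have hsort := (Tuple.eq_sort_iff (f := f)).1 rfl
  have hσ : permWithDescents T = (Tuple.sort f)⁻¹ := rfl
  have hinv : ∀ i, Tuple.sort f (permWithDescents T i) = i := fun i => by simp [hσ]
  have hsub : (T.filter fun t => t ≤ i) ⊆ T.filter fun t => t ≤ j := by
    intro t ht
    rw [Finset.mem_filter] at *
    exact ⟨ht.1, ht.2.trans hij.le⟩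
  have heq : (∀ t ∈ T, i < t → ¬ t ≤ j) ↔ f i = f j := by
    rw [hf]
    simp only [OrderDual.toDual_inj]
    constructor
    · intro h
      congr 1
      refine Finset.Subset.antisymm hsub fun t ht => ?_
      rw [Finset.mem_filter] at *
      exact ⟨ht.1, not_lt.1 fun hlt => h t ht.1 hlt ht.2⟩
    · intro h t ht hit htj
      have := Finset.eq_of_subset_of_card_le hsub h.ge
      have hm : t ∈ T.filter fun t => t ≤ j := Finset.mem_filter.2 ⟨ht, htj⟩
      rw [← this] at hm
      exact absurd (Finset.mem_filter.1 hm).2 (not_le.2 hit)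
  rw [heq]
  constructor
  · intro h
    have h1 := hsort.1 h.le
    simp only [Function.comp_apply, hinv] at h1
    exact le_antisymm h1 (Finset.card_le_card hsub)
  · intro h
    by_contra hcon
    rcases (not_lt.1 hcon).eq_or_lt with he | hlt
    · exact hij.ne' ((permWithDescents T).injective he)
    · have := hsort.2 _ _ hlt (by rw [hinv, hinv, h])
      rw [hinv, hinv] at this
      exact this.not_gt hij

theorem HasIntervalClasses.permWithDescents_mem_iff {n : ℕ} {S : Setoid (Fin n)}
    (hS : HasIntervalClasses S) {T : Finset (Fin n)} (hT : ∀ t ∈ T, 0 < (t : ℕ)) :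
    permWithDescents T ∈ increasingOn S ↔ T ⊆ cuts S := by
  rw [mem_increasingOn]
  constructor
  · intro h t ht
    refine mem_cuts.2 ⟨hT t ht, fun hr => ?_⟩
    have hlt : (⟨t - 1, by omega⟩ : Fin n) < t := Fin.mk_lt_mk.2 (by have := hT t ht; omega)
    exact (permWithDescents_lt_iff hlt).1 (h _ _ hlt hr) t ht hlt le_rfl
  · intro h i j hij hr
    exact (permWithDescents_lt_iff hij).2 fun t ht => (hS.rel_iff hij.le).1 hr t (h ht)

theorem coeff_increasingSum {n : ℕ} (p : ℕ) (S : Setoid (Fin n)) (σ : Equiv.Perm (Fin n)) :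
    (increasingSum p S).coeff σ = if σ ∈ increasingOn S then 1 else 0 := by
  have : (increasingSum p S).coeff =
      ∑ τ ∈ increasingOn S, Finsupp.single τ (1 : ZMod p) := by
    change MonoidAlgebra.coeffLinearEquiv (ZMod p) (increasingSum p S) = _
    rw [increasingSum, map_sum]
    rfl
  rw [this, Finsupp.finsetSum_apply]
  simp [Finsupp.single_apply]

/-- The alternating sum of the coefficients at one permutation for each possible set of descents
inside the classes of `S`. -/
def alternatingCoeff {n : ℕ} (p : ℕ) (S : Setoid (Fin n)) : GroupAlg n p →ₗ[ZMod p] ZMod p :=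
  ∑ T ∈ (Finset.univ.filter fun k : Fin n => 0 < (k : ℕ) ∧ k ∉ cuts S).powerset,
    ((-1 : ZMod p) ^ T.card) • (Finsupp.lapply (permWithDescents T) ∘ₗ
      (MonoidAlgebra.coeffLinearEquiv (ZMod p)).toLinearMap)

theorem alternatingCoeff_increasingSum {n : ℕ} (p : ℕ) {S S' : Setoid (Fin n)}
    (hS : HasIntervalClasses S) (hS' : HasIntervalClasses S') (hle : S' ≤ S) :
    alternatingCoeff p S (increasingSum p S') = if S' = S then 1 else 0 := by
  set A := Finset.univ.filter fun k : Fin n => 0 < (k : ℕ) ∧ k ∉ cuts S with hA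
  have h1 : alternatingCoeff p S (increasingSum p S') =
      ∑ T ∈ A.powerset, (-1 : ZMod p) ^ T.card * (increasingSum p S').coeff (permWithDescents T) := by
    simp only [alternatingCoeff, LinearMap.sum_apply]
    rfl
  have h2 : A.powerset.filter (fun T => T ⊆ cuts S') = (A ∩ cuts S').powerset := by
    ext T
    simp only [Finset.mem_filter, Finset.mem_powerset, Finset.subset_inter_iff]
  have h3 : A ∩ cuts S' = ∅ ↔ S' = S := by
    constructor
    · intro h
      refine le_antisymm hle (hS.le_of_cuts_subset hS' fun k hk => ?_)
      by_contra hcon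
      have : k ∈ A ∩ cuts S' := by
        rw [Finset.mem_inter, hA, Finset.mem_filter]
        exact ⟨⟨Finset.mem_univ _, (mem_cuts.1 hk).1, hcon⟩, hk⟩
      rw [h] at this
      exact absurd this (Finset.notMem_empty _)
    · rintro rfl
      rw [Finset.eq_empty_iff_forall_notMem]
      intro k hk
      rw [Finset.mem_inter, hA, Finset.mem_filter] at hk
      exact hk.1.2.2 hk.2
  have h4 := congrArg (Int.cast : ℤ → ZMod p)
    (Finset.sum_powerset_neg_one_pow_card (x := A ∩ cuts S'))
  rw [Int.cast_sum] at h4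
  simp only [Int.cast_pow, Int.cast_neg, Int.cast_one, h3, Int.cast_ite, Int.cast_zero] at h4
  rw [h1, ← h4, ← h2, Finset.sum_filter]
  refine Finset.sum_congr rfl fun T hT => ?_
  have hT0 : ∀ t ∈ T, 0 < (t : ℕ) := fun t ht =>
    (Finset.mem_filter.1 (Finset.mem_powerset.1 hT ht)).2.1
  rw [coeff_increasingSum]
  simp only [hS'.permWithDescents_mem_iff hT0, mul_ite, mul_one, mul_zero]

theorem hasIntervalClasses_ker {n s : ℕ} {b : Fin n → Fin s} (hb : Monotone b) :
    HasIntervalClasses (Setoid.ker b) := fun _ _ _ hij hjk h =>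
  le_antisymm (hb hij) ((hb hjk).trans (Setoid.ker_def.1 h).ge)

theorem not_isNilpotent_increasingSum {n s p : ℕ} (hp : p.Prime) {b : Fin n → Fin s}
    (hb : Monotone b) (hs : Function.Surjective b) (hd : ¬ p ∣ Fintype.card (FiberSymm b)) :
    ¬ IsNilpotent (increasingSum p (Setoid.ker b)) := by
  have := Fact.mk hp
  set B := increasingSum p (Setoid.ker b) with hB
  set N : ZMod p := (Fintype.card (FiberSymm b) : ZMod p) with hN
  have hN0 : N ≠ 0 := fun h => hd ((ZMod.natCast_eq_zero_iff _ _).1 h)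
  let M : Submodule (ZMod p) (GroupAlg n p) := Submodule.span (ZMod p)
    {x | ∃ S, HasIntervalClasses S ∧ S < Setoid.ker b ∧ x = increasingSum p S}
  have hM : ∀ x ∈ M, B * x ∈ M := by
    intro x hx
    induction hx using Submodule.span_induction with
    | mem x hx =>
      obtain ⟨S, hS, hlt, rfl⟩ := hx
      rw [hB, increasingSum_ker_mul p hb]
      refine M.sum_mem fun h hh => Submodule.subset_span ⟨_, ?_, ?_, rfl⟩
      · exact hS.inf_ker (mem_monotoneRearrangements.1 hh).2
      · exact inf_le_left.trans_lt hlt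
    | zero => rw [mul_zero]; exact M.zero_mem
    | add x y _ _ hx hy => rw [mul_add]; exact M.add_mem hx hy
    | smul a x _ hx => rw [mul_smul_comm]; exact M.smul_mem _ hx
  have hBB : B * B - N • B ∈ M := by
    nth_rewrite 1 [hB]
    nth_rewrite 1 [hB]
    rw [increasingSum_ker_mul p hb,
      ← Finset.sum_filter_add_sum_filter_not _ (fun h => Setoid.ker b ≤ Setoid.ker h),
      Finset.sum_congr rfl fun h hh => by
          rw [inf_eq_left.2 (Finset.mem_filter.1 hh).2], Finset.sum_const,
          ← Nat.cast_smul_eq_nsmul (ZMod p), card_filter_ker_le hs, ← hN, ← hB,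
          add_sub_cancel_left]
    refine M.sum_mem fun h hh => Submodule.subset_span ⟨_, ?_, ?_, rfl⟩
    · exact (hasIntervalClasses_ker hb).inf_ker
        (mem_monotoneRearrangements.1 (Finset.mem_filter.1 hh).1).2
    · exact inf_lt_left.2 (Finset.mem_filter.1 hh).2
  have hpow : ∀ k : ℕ, B ^ (k + 1) - N ^ k • B ∈ M := by
    intro k
    induction k with
    | zero => simp
    | succ k ih =>
      have : B ^ (k + 1 + 1) - N ^ (k + 1) • B =
          B * (B ^ (k + 1) - N ^ k • B) + N ^ k • (B * B - N • B) := by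
        rw [mul_sub, ← pow_succ', mul_smul_comm, smul_sub, smul_smul, ← pow_succ]
        abel
      rw [this]
      exact M.add_mem (hM _ ih) (M.smul_mem _ hBB)
  have hker : M ≤ LinearMap.ker (alternatingCoeff p (Setoid.ker b)) := by
    refine Submodule.span_le.2 ?_
    rintro _ ⟨S, hS, hlt, rfl⟩
    rw [SetLike.mem_coe, LinearMap.mem_ker,
      alternatingCoeff_increasingSum p (hasIntervalClasses_ker hb) hS hlt.le, if_neg hlt.ne]
  rintro ⟨k, hk⟩
  have h := hker (hpow k)
  rw [LinearMap.mem_ker, pow_succ, hk, zero_mul, zero_sub, map_neg, map_smul, hB,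
    alternatingCoeff_increasingSum p (hasIntervalClasses_ker hb) (hasIntervalClasses_ker hb) le_rfl,
    if_pos rfl, smul_eq_mul, mul_one, neg_eq_zero] at h
  exact pow_ne_zero k hN0 h

theorem isNilpotent_increasingSum_iff {n s p : ℕ} (hp : p.Prime) {b : Fin n → Fin s}
    (hb : Monotone b) (hs : Function.Surjective b) :
    IsNilpotent (increasingSum p (Setoid.ker b)) ↔ p ∣ Fintype.card (FiberSymm b) := by
  refine ⟨fun h => by_contra fun hd => not_isNilpotent_increasingSum hp hb hs hd h, fun hd => ?_⟩
  obtain ⟨k, hk⟩ := exists_pow_mul_increasingSum_eq_zero hp hb hs hd ⊤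
  exact ⟨k, by rwa [increasingSum_top, mul_one] at hk⟩

theorem Composition.index_monotone {n : ℕ} (c : Composition n) : Monotone c.index := by
  intro i j hij
  by_contra hcon
  have h1 := c.monotone_sizeUpTo (Nat.succ_le_of_lt (Fin.lt_def.1 (not_le.1 hcon)))
  have h2 := c.sizeUpTo_index_le i
  have h3 := c.lt_sizeUpTo_index_succ j
  have h4 : (i : ℕ) ≤ j := hij
  simp only [Fin.val_succ, Nat.succ_eq_add_one] at h1 h3
  omega

theorem Composition.index_surjective {n : ℕ} (c : Composition n) :
    Function.Surjective c.index := fun i =>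
  ⟨c.embedding i ⟨0, c.one_le_blocksFun i⟩, c.index_embedding i _⟩

theorem Composition.card_index_fiber {n : ℕ} (c : Composition n) (j : Fin c.length) :
    Fintype.card {i // c.index i = j} = c.blocksFun j := by
  rw [← Fintype.card_fin (c.blocksFun j)]
  refine (Fintype.card_congr (Equiv.ofBijective
    (fun x => (⟨c.embedding j x, c.index_embedding j x⟩ : {i // c.index i = j})) ⟨?_, ?_⟩)).symm
  · intro x y h
    exact (c.embedding j).injective (congrArg Subtype.val h)
  · rintro ⟨i, rfl⟩
    exact ⟨c.invEmbedding i, Subtype.ext (c.embedding_comp_inv i)⟩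

theorem Composition.count_blocks {n : ℕ} (c : Composition n) (m : ℕ) :
    c.blocks.count m = Fintype.card {j // c.blocksFun j = m} := by
  rw [← c.ofFn_blocksFun, List.ofFn_eq_map, ← Multiset.coe_count, ← Multiset.map_coe,
    Multiset.count_map, Fintype.card_subtype]
  simp only [eq_comm (a := m)]
  rfl

theorem Composition.mem_properPartialSums_iff {n : ℕ} (c : Composition n) {k : ℕ} (hk : k < n)
    (h0 : 0 < k) :
    k ∈ properPartialSums c ↔ c.index ⟨k - 1, by omega⟩ ≠ c.index ⟨k, hk⟩ := by
  constructor
  · rintro ⟨i, hi0, hi, rfl⟩ he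
    have h1 := c.sizeUpTo_index_le ⟨c.sizeUpTo i - 1, by omega⟩
    have h2 := c.lt_sizeUpTo_index_succ ⟨c.sizeUpTo i, hk⟩
    rw [← he] at h2
    simp only [Fin.val_succ] at h1 h2
    rcases le_or_gt i (c.index ⟨c.sizeUpTo i - 1, by omega⟩ : ℕ) with h | h
    · have := c.monotone_sizeUpTo h
      omega
    · have := c.monotone_sizeUpTo (Nat.succ_le_of_lt h)
      simp only [Nat.succ_eq_add_one] at this
      omega
  · intro hne
    have hlt : c.index ⟨k - 1, by omega⟩ < c.index ⟨k, hk⟩ :=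
      lt_of_le_of_ne (c.index_monotone (Fin.mk_le_mk.2 (Nat.sub_le _ _))) hne
    have h1 := c.sizeUpTo_index_le ⟨k, hk⟩
    have h2 := c.lt_sizeUpTo_index_succ ⟨k - 1, by omega⟩
    have h3 := c.monotone_sizeUpTo (Nat.succ_le_of_lt (Fin.lt_def.1 hlt))
    simp only [Fin.val_succ, Nat.succ_eq_add_one] at h1 h2 h3
    exact ⟨c.index ⟨k, hk⟩, (Nat.zero_le _).trans_lt (Fin.lt_def.1 hlt), (c.index _).2, by omega⟩

theorem descSet_subset_iff {n : ℕ} (c : Composition n) (σ : Equiv.Perm (Fin n)) :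
    descSet σ ⊆ properPartialSums c ↔ σ ∈ increasingOn (Setoid.ker c.index) := by
  rw [mem_increasingOn]
  constructor
  · intro h i j hij hr
    obtain ⟨j, hj⟩ := j
    induction j with
    | zero => exact absurd hij (Nat.not_lt_zero _)
    | succ j ih =>
      have hij' : i ≤ ⟨j, by omega⟩ := Nat.le_of_lt_succ hij
      have hr' : c.index i = c.index ⟨j, by omega⟩ :=
        hasIntervalClasses_ker c.index_monotone _ _ ⟨j + 1, hj⟩ hij'
          (Fin.mk_le_mk.2 (Nat.le_succ _)) hr
      have hstep : σ ⟨j, by omega⟩ < σ ⟨j + 1, hj⟩ := by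
        by_contra hcon
        have hlt : σ ⟨j + 1, hj⟩ < σ ⟨j, by omega⟩ :=
          lt_of_le_of_ne (not_lt.1 hcon) fun he => by
            have := congrArg Fin.val (σ.injective he)
            simp at this
        have hd : j + 1 ∈ descSet σ := ⟨hj, Nat.succ_pos _, hlt⟩
        exact (c.mem_properPartialSums_iff hj (Nat.succ_pos _)).1 (h hd)
          (hr'.symm.trans (Setoid.ker_def.1 hr))
      rcases hij'.eq_or_lt with heq | hlt
      · rwa [heq]
      · exact (ih (by omega) hlt hr').trans hstep
  · rintro h k ⟨hk, h0, hlt⟩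
    rw [c.mem_properPartialSums_iff hk h0]
    intro he
    exact (h _ _ (Fin.mk_lt_mk.2 (by omega)) he).not_gt hlt

theorem Bel_eq_increasingSum (n p : ℕ) (c : Composition n) :
    Bel n p c = increasingSum p (Setoid.ker c.index) := by
  unfold Bel increasingSum
  refine Finset.sum_congr ?_ fun _ _ => rfl
  ext σ
  rw [Finset.mem_filter, descSet_subset_iff]
  simp

theorem prime_dvd_card_fiberSymm_index_iff {n p : ℕ} (hp : p.Prime) (c : Composition n) :
    p ∣ Fintype.card (FiberSymm c.index) ↔ ∃ i, p ≤ c.blocks.count i := by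
  have h : Fintype.card (FiberSymm c.index) =
      Fintype.card {g : Equiv.Perm (Fin c.length) // c.blocksFun ∘ g = c.blocksFun} :=
    Fintype.card_congr (Equiv.subtypeEquivRight fun g => by simp only [c.card_index_fiber])
  rw [h, DomMulAct.stabilizer_card', hp.prime.dvd_finsetProd_iff]
  simp only [hp.dvd_factorial, c.count_blocks]
  refine ⟨fun ⟨i, _, hi⟩ => ⟨i, by convert hi⟩, fun ⟨i, hi⟩ => ⟨i, ?_, by convert hi⟩⟩
  obtain ⟨j, hj⟩ := Fintype.card_pos_iff.1 (hp.pos.trans_le hi)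
  exact Finset.mem_image.2 ⟨j, Finset.mem_univ _, hj⟩

/-- The basis element `B̄_r` of `Σ(n,p)` is nilpotent if and only if some
value occurs among the components of `r` with multiplicity `p` or more. -/
theorem stmt7 (n p : ℕ) (hn : 1 ≤ n) (hp : p.Prime) (r : Composition n) :
    IsNilpotent (Bel n p r) ↔ ∃ i : ℕ, p ≤ r.blocks.count i := by
  rw [Bel_eq_increasingSum,
    isNilpotent_increasingSum_iff hp r.index_monotone r.index_surjective,
    prime_dvd_card_fiberSymm_index_iff hp]

end
end

section
/- The dimension over F_p of the Jacobson radical R(n,p) of Σ(n,p) is at least 2^{n−1} − g(n,p), where g(n,p) is the number of partitions of n having no part divisible by p. -/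
open scoped Classical

set_option synthInstance.maxHeartbeats 1000000
set_option maxHeartbeats 1000000

noncomputable section

namespace Composition

variable {n : ℕ} (q r : Composition n)

theorem monotone_index : Monotone q.index := by
  intro i j hij
  by_contra! h
  have h1 := q.sizeUpTo_index_le i
  have h2 := q.lt_sizeUpTo_index_succ j
  have h3 : q.sizeUpTo (q.index j).succ ≤ q.sizeUpTo (q.index i) :=
    q.monotone_sizeUpTo (by simpa using h)
  have h4 : (i : ℕ) ≤ j := hij
  omega

theorem index_lt_index_iff {k : ℕ} (hk : k < n) (h0 : 0 < k) :
    q.index ⟨k - 1, by omega⟩ < q.index ⟨k, hk⟩ ↔ k ∈ properPartialSums q := by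
  have h1 := q.sizeUpTo_index_le ⟨k - 1, by omega⟩
  have h2 := q.lt_sizeUpTo_index_succ ⟨k - 1, by omega⟩
  have h3 := q.sizeUpTo_index_le ⟨k, hk⟩
  have h4 := q.lt_sizeUpTo_index_succ ⟨k, hk⟩
  dsimp only [Fin.val_succ] at h1 h2 h3 h4
  constructor
  · intro h
    have h5 : ((q.index ⟨k - 1, by omega⟩ : ℕ) + 1) ≤ q.index ⟨k, hk⟩ := h
    have h6 := q.monotone_sizeUpTo h5
    exact ⟨q.index ⟨k, hk⟩, by omega, (q.index ⟨k, hk⟩).2, by omega⟩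
  · rintro ⟨i, hi0, hil, hki⟩
    have h5 : (q.index ⟨k - 1, by omega⟩ : ℕ) < i := by
      by_contra! h
      have := q.monotone_sizeUpTo h
      omega
    have h6 : i ≤ (q.index ⟨k, hk⟩ : ℕ) := by
      by_contra! h
      have := q.monotone_sizeUpTo (Nat.succ_le_of_lt h)
      simp only [Nat.succ_eq_add_one] at this
      omega
    exact Fin.lt_def.2 (by omega)

theorem mem_boundaries_iff (j : Fin (n + 1)) :
    j ∈ q.boundaries ↔ j = 0 ∨ j = Fin.last n ∨ (j : ℕ) ∈ properPartialSums q := by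
  simp only [boundaries, Finset.mem_map, Finset.mem_univ, true_and]
  constructor
  · rintro ⟨i, rfl⟩
    by_cases h0 : (i : ℕ) = 0
    · left
      have : i = 0 := Fin.ext h0
      simp [this]
    by_cases hl : (i : ℕ) = q.length
    · right; left
      have : i = Fin.last _ := Fin.ext hl
      simp [this]
    · exact Or.inr (Or.inr ⟨i, by omega, by omega, rfl⟩)
  · rintro (rfl | rfl | ⟨i, h0, hl, hj⟩)
    · exact ⟨0, q.boundary_zero⟩
    · exact ⟨Fin.last _, q.boundary_last⟩
    · exact ⟨⟨i, by omega⟩, Fin.ext hj.symm⟩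

variable {q r}

theorem boundaries_subset_of_properPartialSums_subset
    (h : properPartialSums q ⊆ properPartialSums r) : q.boundaries ⊆ r.boundaries := by
  intro j hj
  rw [mem_boundaries_iff] at hj ⊢
  exact hj.imp_right (Or.imp_right fun h' => h h')

theorem boundaries_injective : Function.Injective (boundaries : Composition n → _) := by
  intro q r h
  exact (compositionEquiv n).injective (CompositionAsSet.ext h)

theorem card_fiber_index (q : Composition n) (i : Fin q.length) :
    (Finset.univ.filter fun x => q.index x = i).card = q.blocksFun i := by
  rw [← Fintype.card_subtype, ← Fintype.card_fin (q.blocksFun i)]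
  refine Fintype.card_congr (Equiv.symm (Equiv.trans ?_
    (Equiv.subtypeEquiv q.blocksFinEquiv (p := fun s => s.1 = i) ?_)))
  · exact (Equiv.sigmaSubtype (β := fun i => Fin (q.blocksFun i)) i).symm
  · rintro ⟨a, b⟩
    simp [blocksFinEquiv, index_embedding]

/-- The ordered set partitions of type `q`, given by the map sending a point to the index of its
block. -/
def blockMaps (q : Composition n) : Finset (Fin n → Fin q.length) :=
  Finset.univ.filter fun f => ∀ i, (Finset.univ.filter fun x => f x = i).card = q.blocksFun i

theorem mem_blockMaps {f : Fin n → Fin q.length} :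
    f ∈ q.blockMaps ↔ ∀ i, (Finset.univ.filter fun x => f x = i).card = q.blocksFun i := by
  simp [blockMaps]

theorem comp_perm_mem_blockMaps {f : Fin n → Fin q.length} (hf : f ∈ q.blockMaps)
    (τ : Equiv.Perm (Fin n)) : f ∘ τ ∈ q.blockMaps := by
  rw [mem_blockMaps] at hf ⊢
  intro i
  rw [← hf i]
  exact Finset.card_equiv τ (by simp)

theorem index_mem_blockMaps (q : Composition n) : q.index ∈ q.blockMaps :=
  mem_blockMaps.2 q.card_fiber_index

theorem exists_perm_of_mem_blockMaps {f : Fin n → Fin q.length} (hf : f ∈ q.blockMaps) :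
    ∃ τ : Equiv.Perm (Fin n), f = q.index ∘ τ := by
  have h : ∀ i, Nonempty ({x // f x = i} ≃ {x // q.index x = i}) := fun i => by
    refine ⟨Fintype.equivOfCardEq ?_⟩
    rw [Fintype.card_subtype, Fintype.card_subtype, card_fiber_index, mem_blockMaps.1 hf]
  let e := fun i => (h i).some
  refine ⟨(Equiv.sigmaFiberEquiv f).symm.trans ((Equiv.sigmaCongrRight e).trans
    (Equiv.sigmaFiberEquiv q.index)), funext fun x => ?_⟩
  exact (e (f x) ⟨x, rfl⟩).2.symm

theorem comp_sort_eq_index {f : Fin n → Fin q.length} (hf : f ∈ q.blockMaps) :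
    f ∘ Tuple.sort f = q.index := by
  obtain ⟨τ, rfl⟩ := exists_perm_of_mem_blockMaps hf
  have h1 : Monotone ((q.index ∘ τ) ∘ Tuple.sort (q.index ∘ τ)) := Tuple.monotone_sort _
  have h3 : (q.index ∘ τ) ∘ τ.symm = q.index := by
    ext x
    simp
  have h2 : Monotone ((q.index ∘ τ) ∘ τ.symm) := by
    rw [h3]
    exact q.monotone_index
  rw [Tuple.unique_monotone h1 h2, h3]

end Composition

theorem descSet_subset_iff_s8 {n : ℕ} {q : Composition n} {σ : Equiv.Perm (Fin n)} :
    descSet σ ⊆ properPartialSums q ↔ ∀ i j, i < j → q.index i = q.index j → σ i < σ j := by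
  constructor
  · rintro h ⟨i, hi⟩ ⟨j, hj⟩ hij hq
    obtain ⟨d, rfl⟩ : ∃ d, j = i + 1 + d := ⟨j - (i + 1), by
      have : i < j := hij
      omega⟩
    have step : ∀ k (hk : k + 1 < n), i ≤ k → k + 1 ≤ i + 1 + d →
        σ ⟨k, by omega⟩ < σ ⟨k + 1, hk⟩ := by
      intro k hk hik hkj
      by_contra hlt
      have hne : σ ⟨k + 1, hk⟩ ≠ σ ⟨k, by omega⟩ := by simp
      have hd : k + 1 ∈ descSet σ :=
        ⟨hk, by omega, lt_of_le_of_ne (not_lt.1 hlt) hne⟩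
      have h1 := (q.index_lt_index_iff hk (by omega)).2 (h hd)
      have h2 : q.index ⟨i, hi⟩ ≤ q.index ⟨k + 1 - 1, by omega⟩ :=
        q.monotone_index (Fin.mk_le_mk.2 (by omega))
      have h3 : q.index ⟨k + 1, hk⟩ ≤ q.index ⟨i + 1 + d, hj⟩ :=
        q.monotone_index (Fin.mk_le_mk.2 hkj)
      exact absurd (hq ▸ (h2.trans_lt h1).trans_le h3) (lt_irrefl _)
    have main : ∀ e (he : i + 1 + e < n), e ≤ d → σ ⟨i, hi⟩ < σ ⟨i + 1 + e, he⟩ := by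
      intro e
      induction e with
      | zero => intro he _; exact step i he le_rfl (by omega)
      | succ e ih =>
        intro he hed
        exact (ih (by omega) (by omega)).trans (step (i + 1 + e) he (by omega) (by omega))
    exact main d hj le_rfl
  · rintro h k ⟨hk, h0, hlt⟩
    rw [← q.index_lt_index_iff hk h0]
    refine lt_of_le_of_ne (q.monotone_index (Fin.mk_le_mk.2 (by omega))) fun he => ?_
    exact absurd (h _ _ (Fin.mk_lt_mk.2 (by omega)) he) hlt.asymm

theorem exists_descSet_eq {n : ℕ} (q : Composition n) :
    ∃ σ : Equiv.Perm (Fin n), descSet σ = properPartialSums q := by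
  let f : Fin n → (Fin q.length)ᵒᵈ := fun i => OrderDual.toDual (q.index i)
  obtain ⟨hm, hs⟩ := Tuple.eq_sort_iff.1 (rfl : Tuple.sort f = Tuple.sort f)
  refine ⟨(Tuple.sort f).symm, Set.Subset.antisymm (descSet_subset_iff_s8.2 fun i j hij he => ?_) ?_⟩
  · by_contra! hle
    rcases hle.lt_or_eq with hlt | heq
    · have := hs _ _ hlt (by simp [f, he])
      simp only [Equiv.apply_symm_apply] at this
      exact hij.asymm this
    · exact hij.ne' ((Equiv.injective _) heq)
  · rintro k hk
    obtain ⟨hkn, h0⟩ : k < n ∧ 0 < k := by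
      obtain ⟨i, h0, hl, rfl⟩ := hk
      have h1 := q.sizeUpTo_strict_mono hl
      have h2 := q.sizeUpTo_le (i + 1)
      have h3 := q.sizeUpTo_strict_mono (i := 0) (by omega)
      have h4 := q.monotone_sizeUpTo (show 0 + 1 ≤ i by omega)
      omega
    refine ⟨hkn, h0, ?_⟩
    have hlt := (q.index_lt_index_iff hkn h0).2 hk
    by_contra! hle
    have := hm hle
    simp only [Function.comp_apply, Equiv.apply_symm_apply] at this
    exact absurd hlt (not_lt.2 (OrderDual.toDual_le_toDual.1 this))

namespace MvPolynomial

variable {σ : Type*} [Fintype σ] {p : ℕ} [Fact p.Prime]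

theorem psum_ordCompl_pow_ordProj (m : ℕ) :
    psum σ (ZMod p) (m / p ^ m.factorization p) ^ p ^ m.factorization p =
      psum σ (ZMod p) m := by
  rw [psum, sum_pow_char_pow, psum]
  simp only [← pow_mul, Nat.div_mul_cancel (Nat.ordProj_dvd m p)]

theorem prod_X_comp {n : ℕ} [DecidableEq σ] (f : Fin n → σ) :
    ∏ x, (X (f x) : MvPolynomial σ (ZMod p)) =
      monomial (Finsupp.equivFunOnFinite.symm
        fun i => (Finset.univ.filter fun x => f x = i).card) 1 := by
  rw [monomial_eq, Finsupp.prod_fintype _ _ (by simp)]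
  simp only [map_one, one_mul, Finsupp.equivFunOnFinite_symm_apply_apply]
  rw [← Finset.prod_fiberwise Finset.univ f]
  refine Finset.prod_congr rfl fun i _ => ?_
  rw [Finset.prod_congr rfl (g := fun _ => (X i : MvPolynomial σ (ZMod p))), Finset.prod_const]
  intro x hx
  rw [(Finset.mem_filter.1 hx).2]

end MvPolynomial

/-- The mod-`p` Young character of type `q` at the cycle type `μ`, as a coefficient of a product
of power sums. -/
def youngCoeff {n : ℕ} (p : ℕ) (q : Composition n) (μ : Multiset ℕ) : ZMod p :=
  MvPolynomial.coeff (Finsupp.equivFunOnFinite.symm q.blocksFun)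
    (μ.map (MvPolynomial.psum (Fin q.length) (ZMod p))).prod

/-- The number of points in a class of a setoid on `Fin n`. -/
def classSize {n : ℕ} (s : Setoid (Fin n)) (c : Quotient s) : ℕ :=
  (Finset.univ.filter fun x : Fin n => (⟦x⟧ : Quotient s) = c).card

theorem sum_classSize {n : ℕ} (s : Setoid (Fin n)) : ∑ c, classSize s c = n := by
  have := Finset.card_eq_sum_card_fiberwise (s := (Finset.univ : Finset (Fin n)))
    (t := Finset.univ) (f := fun x => (⟦x⟧ : Quotient s)) (by simp)
  simpa [classSize] using this.symm

theorem classSize_ne_zero {n : ℕ} (s : Setoid (Fin n)) (c : Quotient s) : classSize s c ≠ 0 := by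
  obtain ⟨x, rfl⟩ := Quotient.exists_rep c
  exact Finset.card_ne_zero_of_mem (a := x) (by simp)

theorem card_blockMaps_eq_youngCoeff {n p : ℕ} [Fact p.Prime] (e : Fin n → Fin n → Prop)
    (q : Composition n) :
    ((q.blockMaps.filter fun f => ∀ x y, e x y → f x = f y).card : ZMod p) =
      youngCoeff p q
        (Finset.univ.val.map (classSize (Relation.EqvGen.setoid e))) := by
  set s := Relation.EqvGen.setoid e
  have key : ∀ g : Quotient s → Fin q.length,
      ∏ c, (MvPolynomial.X (g c) : MvPolynomial (Fin q.length) (ZMod p)) ^ classSize s c =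
        ∏ x : Fin n, MvPolynomial.X (g ⟦x⟧) := by
    intro g
    rw [← Finset.prod_fiberwise Finset.univ (fun x => (⟦x⟧ : Quotient s))]
    refine Finset.prod_congr rfl fun c _ => ?_
    rw [Finset.prod_congr rfl
      (g := fun _ => (MvPolynomial.X (g c) : MvPolynomial (Fin q.length) (ZMod p))),
      Finset.prod_const, classSize]
    intro x hx
    rw [(Finset.mem_filter.1 hx).2]
  have hprod : ((Finset.univ.val.map (classSize s)).map
      (MvPolynomial.psum (Fin q.length) (ZMod p))).prod =
      ∑ g : Quotient s → Fin q.length, ∏ x : Fin n, MvPolynomial.X (g ⟦x⟧) := by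
    rw [Multiset.map_map]
    change ∏ c, MvPolynomial.psum (Fin q.length) (ZMod p) (classSize s c) = _
    simp only [MvPolynomial.psum, Fintype.prod_sum, key]
  rw [youngCoeff, hprod, MvPolynomial.coeff_sum]
  simp only [MvPolynomial.prod_X_comp, MvPolynomial.coeff_monomial,
    EmbeddingLike.apply_eq_iff_eq]
  rw [Finset.sum_boole]
  congr 1
  symm
  refine Finset.card_bij (fun g _ x => g ⟦x⟧) ?_ ?_ ?_
  · intro g hg
    simp only [Finset.mem_filter, Finset.mem_univ, true_and] at hg
    refine Finset.mem_filter.2 ⟨Composition.mem_blockMaps.2 fun i => congrFun hg i, ?_⟩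
    intro x y hxy
    exact congrArg g (Quotient.sound (Relation.EqvGen.rel x y hxy))
  · intro g _ g' _ h
    funext c
    obtain ⟨x, rfl⟩ := Quotient.exists_rep c
    exact congrFun h x
  · intro f hf
    obtain ⟨hf, hfe⟩ := Finset.mem_filter.1 hf
    have hl : ∀ x y, s x y → f x = f y := by
      intro x y h
      induction h with
      | rel x y h => exact hfe x y h
      | refl => rfl
      | symm _ _ _ ih => exact ih.symm
      | trans _ _ _ _ _ ih1 ih2 => exact ih1.trans ih2
    refine ⟨Quotient.lift f hl, ?_, rfl⟩
    simp only [Finset.mem_filter, Finset.mem_univ, true_and]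
    exact funext fun i => Composition.mem_blockMaps.1 hf i

theorem exists_regular_partition_youngCoeff_eq {n p : ℕ} [hp : Fact p.Prime]
    (e : Fin n → Fin n → Prop) :
    ∃ π : n.Partition, (∀ i ∈ π.parts, ¬ p ∣ i) ∧ ∀ q : Composition n,
      ((q.blockMaps.filter fun f => ∀ x y, e x y → f x = f y).card : ZMod p) =
        youngCoeff p q π.parts := by
  let s := Relation.EqvGen.setoid e
  let proj : Quotient s → ℕ := fun c => p ^ (classSize s c).factorization p
  let compl : Quotient s → ℕ := fun c => classSize s c / proj c
  let parts : Multiset ℕ := ∑ c, Multiset.replicate (proj c) (compl c)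
  have hmem : ∀ i ∈ parts, ∃ c, i = compl c := by
    intro i hi
    obtain ⟨c, -, hc⟩ := Multiset.mem_sum.1 hi
    exact ⟨c, Multiset.eq_of_mem_replicate hc⟩
  refine ⟨⟨parts, ?_, ?_⟩, ?_, ?_⟩
  · intro i hi
    obtain ⟨c, rfl⟩ := hmem i hi
    exact Nat.ordCompl_pos p (classSize_ne_zero s c)
  · simp only [parts, Multiset.sum_sum, Multiset.sum_replicate, smul_eq_mul]
    exact (Finset.sum_congr rfl fun c _ => Nat.mul_div_cancel' (Nat.ordProj_dvd _ p)).trans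
      (sum_classSize s)
  · intro i hi
    obtain ⟨c, rfl⟩ := hmem i hi
    exact Nat.not_dvd_ordCompl hp.out (classSize_ne_zero s c)
  · intro q
    rw [card_blockMaps_eq_youngCoeff, youngCoeff, youngCoeff]
    congr 1
    simp only [parts]
    rw [← Multiset.coe_mapAddMonoidHom, map_sum, Multiset.prod_sum, Multiset.coe_mapAddMonoidHom,
      Multiset.map_map]
    refine Finset.prod_congr rfl fun c _ => ?_
    simp [proj, compl, MvPolynomial.psum_ordCompl_pow_ordProj, s]

/-- Binary relations on `α`, made into a monoid by lexicographic refinement: total preorders are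
the ordered set partitions of `α`, and form a submonoid, the face monoid of the braid
arrangement. -/
@[ext]
structure LexRel (α : Type*) where
  /-- The underlying relation. -/
  rel : α → α → Prop

namespace LexRel

variable {α : Type*}

instance : Monoid (LexRel α) where
  mul r s := ⟨fun x y => r.rel x y ∧ (r.rel y x → s.rel x y)⟩
  one := ⟨fun _ _ => True⟩
  mul_assoc r s t := by
    ext x y
    change (r.rel x y ∧ (r.rel y x → s.rel x y)) ∧
      (r.rel y x ∧ (r.rel x y → s.rel y x) → t.rel x y) ↔
      r.rel x y ∧ (r.rel y x → s.rel x y ∧ (s.rel y x → t.rel x y))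
    tauto
  one_mul r := by
    ext x y
    change True ∧ (True → r.rel x y) ↔ r.rel x y
    tauto
  mul_one r := by
    ext x y
    change r.rel x y ∧ (r.rel y x → True) ↔ r.rel x y
    tauto

theorem mul_rel (r s : LexRel α) (x y : α) :
    (r * s).rel x y ↔ r.rel x y ∧ (r.rel y x → s.rel x y) := Iff.rfl

theorem one_rel (x y : α) : (1 : LexRel α).rel x y := trivial

/-- The pairs of points that `r` does not separate. -/
def support (r : LexRel α) : Set (α × α) := {z | r.rel z.1 z.2 ∧ r.rel z.2 z.1}

theorem support_mul (r s : LexRel α) : (r * s).support = r.support ∩ s.support := by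
  ext ⟨x, y⟩
  simp only [support, mul_rel, Set.mem_ofPred_eq, Set.mem_inter_iff]
  tauto

theorem support_one : (1 : LexRel α).support = Set.univ := by
  ext z
  simp [support, one_rel]

theorem mul_eq_left_of_support_subset {r s : LexRel α} (h : r.support ⊆ s.support) :
    r * s = r := by
  ext x y
  rw [mul_rel]
  exact ⟨fun h' => h'.1, fun h' => ⟨h', fun h'' => (h (show (x, y) ∈ r.support from ⟨h', h''⟩)).1⟩⟩

/-- The monoid homomorphism testing whether the support contains `e`. -/
def supportHom (k : Type*) [CommRing k] (e : Set (α × α)) : LexRel α →* k where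
  toFun r := if e ⊆ r.support then 1 else 0
  map_one' := by simp [support_one]
  map_mul' r s := by
    simp only [support_mul, Set.subset_inter_iff]
    split_ifs <;> simp_all

/-- Transporting a relation along a permutation. -/
def permute (τ : Equiv.Perm α) : LexRel α →* LexRel α where
  toFun r := ⟨fun x y => r.rel (τ.symm x) (τ.symm y)⟩
  map_one' := rfl
  map_mul' _ _ := rfl

/-- The total preorder whose blocks are the fibres of `f`. -/
def ofMap {β : Type*} [LE β] (f : α → β) : LexRel α := ⟨fun x y => f x ≤ f y⟩

theorem permute_ofMap {β : Type*} [LE β] (f : α → β) (τ : Equiv.Perm α) :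
    permute τ (ofMap f) = ofMap (f ∘ τ.symm) := rfl

theorem subset_support_ofMap {β : Type*} [PartialOrder β] {f : α → β} {e : Set (α × α)} :
    e ⊆ (ofMap f).support ↔ ∀ x y, (x, y) ∈ e → f x = f y := by
  constructor
  · exact fun h x y hxy => le_antisymm (h hxy).1 (h hxy).2
  · exact fun h ⟨x, y⟩ hxy => ⟨(h x y hxy).le, (h x y hxy).ge⟩

/-- The linear order on points listing them as `σ 0, σ 1, …`. -/
def chamber {n : ℕ} (σ : Equiv.Perm (Fin n)) : LexRel (Fin n) := ofMap σ.symm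

theorem permute_chamber {n : ℕ} (σ τ : Equiv.Perm (Fin n)) :
    permute τ (chamber σ) = chamber (τ * σ) := rfl

theorem chamber_injective {n : ℕ} : Function.Injective (chamber : Equiv.Perm (Fin n) → _) := by
  intro σ τ h
  have hm : Monotone (id ∘ (σ.symm * τ : Equiv.Perm (Fin n))) := by
    intro i j hij
    have h1 : (chamber τ).rel (τ i) (τ j) := by simpa [chamber, ofMap] using hij
    rw [← h] at h1
    exact h1
  have := Tuple.unique_monotone (f := id) hm (τ := 1) monotone_id
  ext x
  have hx := congrFun this x
  simp only [Function.comp_apply, id, Equiv.Perm.mul_apply, Equiv.Perm.one_apply] at hx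
  rw [Equiv.symm_apply_eq] at hx
  rw [hx]

theorem ofMap_mul_chamber_one {n : ℕ} {β : Type*} [LinearOrder β] (f : Fin n → β) :
    ofMap f * chamber 1 = chamber (Tuple.sort f) := by
  obtain ⟨hm, hs⟩ := Tuple.eq_sort_iff.1 (rfl : Tuple.sort f = Tuple.sort f)
  ext x y
  obtain ⟨i, rfl⟩ := (Tuple.sort f).surjective x
  obtain ⟨j, rfl⟩ := (Tuple.sort f).surjective y
  simp only [mul_rel, chamber, ofMap, Equiv.symm_apply_apply]
  change f _ ≤ f _ ∧ (f _ ≤ f _ → Tuple.sort f i ≤ Tuple.sort f j) ↔ _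
  constructor
  · rintro ⟨h1, h2⟩
    by_contra! hji
    have h3 := hm hji.le
    exact absurd (h2 h3) (not_le.2 (hs j i hji (le_antisymm h3 h1)))
  · intro hij
    refine ⟨hm hij, fun h => ?_⟩
    rcases hij.eq_or_lt with rfl | hlt
    · exact le_rfl
    · exact (hs i j hlt (le_antisymm (hm hij) h)).le

end LexRel

namespace LexRel

variable {α : Type*} (k : Type*) [CommRing k]

/-- The linear extension of `supportHom`. -/
def supportChar (e : Set (α × α)) : MonoidAlgebra k (LexRel α) →ₐ[k] k :=
  MonoidAlgebra.lift k k (LexRel α) (supportHom k e)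

/-- The span of the relations whose support has fewer than `m` elements. -/
def smallSupport (m : ℕ) : Submodule k (MonoidAlgebra k (LexRel α)) :=
  Submodule.span k (MonoidAlgebra.of k (LexRel α) '' {r | r.support.ncard < m})

variable {k}

theorem supportChar_single (e : Set (α × α)) (r : LexRel α) (c : k) :
    supportChar k e (MonoidAlgebra.single r c) = if e ⊆ r.support then c else 0 := by
  simp [supportChar, supportHom]

theorem single_mul_sub_mem_smallSupport [Finite α] (r : LexRel α)
    (a : MonoidAlgebra k (LexRel α)) :
    MonoidAlgebra.single r 1 * a - supportChar k r.support a • MonoidAlgebra.single r 1 ∈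
      smallSupport k r.support.ncard := by
  induction a using MonoidAlgebra.induction_linear with
  | zero => simp
  | add a b ha hb =>
    convert add_mem ha hb using 1
    rw [mul_add, map_add, add_smul]
    abel
  | single s c =>
    rw [MonoidAlgebra.single_mul_single, one_mul, supportChar_single]
    split_ifs with h
    · rw [mul_eq_left_of_support_subset h]
      simp
    · have hs : (r * s).support.ncard < r.support.ncard := by
        rw [support_mul]
        exact Set.ncard_lt_ncard (Set.inter_subset_left.ssubset_of_not_subset
          fun h' => h (h'.trans Set.inter_subset_right)) (Set.toFinite _)
      have := (smallSupport k r.support.ncard).smul_mem c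
        (Submodule.subset_span ⟨r * s, hs, rfl⟩)
      simpa using this

theorem smallSupport_mono : Monotone (smallSupport (α := α) k) := by
  intro m m' h
  refine Submodule.span_mono (Set.image_mono ?_)
  intro r hr
  exact lt_of_lt_of_le (show r.support.ncard < m from hr) h

theorem mul_mem_smallSupport [Finite α] {a : MonoidAlgebra k (LexRel α)}
    (ha : ∀ e, supportChar k e a = 0) {m : ℕ} {v : MonoidAlgebra k (LexRel α)}
    (hv : v ∈ smallSupport k (m + 1)) : v * a ∈ smallSupport k m := by
  suffices h : smallSupport k (m + 1) ≤
      (smallSupport k m).comap (LinearMap.mulRight k a) from h hv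
  refine Submodule.span_le.2 ?_
  rintro _ ⟨r, hr, rfl⟩
  have hr' : r.support.ncard < m + 1 := hr
  have h := single_mul_sub_mem_smallSupport r a
  rw [ha, zero_smul, sub_zero] at h
  exact smallSupport_mono (Nat.le_of_lt_succ hr') h

theorem isNilpotent_of_supportChar_eq_zero [Finite α] {a : MonoidAlgebra k (LexRel α)}
    (ha : ∀ e, supportChar k e a = 0) : IsNilpotent a := by
  have key : ∀ (m : ℕ) (v : MonoidAlgebra k (LexRel α)), v ∈ smallSupport k m →
      v * a ^ m = 0 := by
    intro m
    induction m with
    | zero =>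
      intro v hv
      have : v = 0 := by simpa [smallSupport] using hv
      simp [this]
    | succ m ih =>
      intro v hv
      rw [pow_succ', ← mul_assoc]
      exact ih _ (mul_mem_smallSupport ha hv)
  refine ⟨(1 : LexRel α).support.ncard + 1, ?_⟩
  rw [← one_mul (a ^ _)]
  exact key _ 1 (Submodule.subset_span ⟨1, Nat.lt_succ_self _, map_one _⟩)

end LexRel

section DescentAlgebra

open LexRel

variable {n p : ℕ}

/-- The sum of all ordered set partitions of type `q`. -/
def orbitSum (p : ℕ) (q : Composition n) : MonoidAlgebra (ZMod p) (LexRel (Fin n)) :=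
  ∑ f ∈ q.blockMaps, MonoidAlgebra.single (ofMap f) 1

/-- Transport along a permutation, extended linearly. -/
def permuteAlg (p : ℕ) (τ : Equiv.Perm (Fin n)) :
    MonoidAlgebra (ZMod p) (LexRel (Fin n)) →ₐ[ZMod p] MonoidAlgebra (ZMod p) (LexRel (Fin n)) :=
  MonoidAlgebra.mapDomainAlgHom (ZMod p) (ZMod p) (permute τ)

theorem permuteAlg_single (τ : Equiv.Perm (Fin n)) (r : LexRel (Fin n)) (c : ZMod p) :
    permuteAlg p τ (MonoidAlgebra.single r c) = MonoidAlgebra.single (permute τ r) c := by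
  simp [permuteAlg]

/-- The embedding of the group algebra as the span of the chambers. -/
def chamberMap (n p : ℕ) : GroupAlg n p →ₗ[ZMod p] MonoidAlgebra (ZMod p) (LexRel (Fin n)) :=
  MonoidAlgebra.mapDomainLinearMap (ZMod p) (ZMod p) chamber

theorem chamberMap_single (σ : Equiv.Perm (Fin n)) (c : ZMod p) :
    chamberMap n p (MonoidAlgebra.single σ c) = MonoidAlgebra.single (chamber σ) c := by
  simp [chamberMap]

theorem chamberMap_injective : Function.Injective (chamberMap n p) := by
  intro a b h
  have h' : a.coeff.mapDomain chamber = b.coeff.mapDomain chamber :=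
    congrArg MonoidAlgebra.coeff h
  exact MonoidAlgebra.coeff_injective (Finsupp.mapDomain_injective chamber_injective h')

theorem permuteAlg_chamberMap (σ : Equiv.Perm (Fin n)) (b : GroupAlg n p) :
    permuteAlg p σ (chamberMap n p b) = chamberMap n p (MonoidAlgebra.single σ 1 * b) := by
  induction b using MonoidAlgebra.induction_linear with
  | zero => simp
  | add a b ha hb => rw [map_add, map_add, ha, hb, mul_add, map_add]
  | single τ c =>
    rw [chamberMap_single, permuteAlg_single, permute_chamber, MonoidAlgebra.single_mul_single,
      one_mul, chamberMap_single]

/-- The permuteling-invariant `a` acts on the chambers as right multiplication by `b`. -/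
def ActsAs (a : MonoidAlgebra (ZMod p) (LexRel (Fin n))) (b : GroupAlg n p) : Prop :=
  (∀ τ, permuteAlg p τ a = a) ∧ a * MonoidAlgebra.single (chamber 1) 1 = chamberMap n p b

namespace ActsAs

variable {a a' : MonoidAlgebra (ZMod p) (LexRel (Fin n))} {b b' : GroupAlg n p}

theorem mul_chamberMap (h : ActsAs a b) (c : GroupAlg n p) :
    a * chamberMap n p c = chamberMap n p (c * b) := by
  induction c using MonoidAlgebra.induction_linear with
  | zero => simp
  | add c d hc hd => rw [map_add, mul_add, hc, hd, add_mul, map_add]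
  | single σ c =>
    have h1 : MonoidAlgebra.single σ c = c • (MonoidAlgebra.single σ 1 : GroupAlg n p) := by simp
    have h2 : a * chamberMap n p (MonoidAlgebra.single σ 1) =
        permuteAlg p σ (a * MonoidAlgebra.single (chamber 1) 1) := by
      rw [map_mul, h.1, permuteAlg_single, permute_chamber, mul_one, chamberMap_single]
    rw [h1, map_smul, mul_smul_comm, h2, h.2, permuteAlg_chamberMap, smul_mul_assoc, map_smul]

theorem one : ActsAs (1 : MonoidAlgebra (ZMod p) (LexRel (Fin n))) 1 := by
  refine ⟨fun τ => map_one _, ?_⟩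
  rw [one_mul, MonoidAlgebra.one_def, chamberMap_single]

theorem zero : ActsAs (0 : MonoidAlgebra (ZMod p) (LexRel (Fin n))) 0 :=
  ⟨fun τ => map_zero _, by simp⟩

theorem add (h : ActsAs a b) (h' : ActsAs a' b') : ActsAs (a + a') (b + b') :=
  ⟨fun τ => by rw [map_add, h.1, h'.1], by rw [add_mul, h.2, h'.2, map_add]⟩

theorem smul (c : ZMod p) (h : ActsAs a b) : ActsAs (c • a) (c • b) :=
  ⟨fun τ => by rw [map_smul, h.1], by rw [smul_mul_assoc, h.2, map_smul]⟩

theorem mul (h : ActsAs a b) (h' : ActsAs a' b') : ActsAs (a * a') (b' * b) :=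
  ⟨fun τ => by rw [map_mul, h.1, h'.1], by rw [mul_assoc, h'.2, h.mul_chamberMap]⟩

theorem pow (h : ActsAs a b) (m : ℕ) : ActsAs (a ^ m) (b ^ m) := by
  induction m with
  | zero => simpa using one
  | succ m ih =>
    rw [pow_succ, pow_succ']
    exact ih.mul h

theorem isNilpotent (h : ActsAs a b) (ha : IsNilpotent a) : IsNilpotent b := by
  obtain ⟨m, hm⟩ := ha
  refine ⟨m, chamberMap_injective ?_⟩
  rw [← (h.pow m).2, hm, zero_mul, map_zero]

end ActsAs

theorem actsAs_orbitSum (q : Composition n) : ActsAs (orbitSum p q) (Bel n p q) := by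
  constructor
  · intro τ
    simp only [orbitSum, map_sum, permuteAlg_single, permute_ofMap]
    refine Finset.sum_bij' (fun f _ => f ∘ τ.symm) (fun f _ => f ∘ τ)
      (fun f hf => Composition.comp_perm_mem_blockMaps hf _)
      (fun f hf => Composition.comp_perm_mem_blockMaps hf _) ?_ ?_ (fun _ _ => rfl)
    · intro f _
      ext
      simp
    · intro f _
      ext
      simp
  · simp only [orbitSum, Finset.sum_mul, MonoidAlgebra.single_mul_single, mul_one,
      ofMap_mul_chamber_one, Bel, map_sum, MonoidAlgebra.of_apply, chamberMap_single]
    have hsort : ∀ σ : Equiv.Perm (Fin n), descSet σ ⊆ properPartialSums q →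
        Tuple.sort (q.index ∘ σ.symm) = σ := by
      intro σ hσ
      refine (Tuple.eq_sort_iff.2 ⟨?_, fun i j hij hq => ?_⟩).symm
      · simpa [Function.comp_assoc] using q.monotone_index
      · exact descSet_subset_iff_s8.1 hσ i j hij (by simpa using hq)
    refine Finset.sum_bij' (fun f _ => Tuple.sort f) (fun σ _ => q.index ∘ σ.symm) ?_ ?_ ?_ ?_
      (fun _ _ => rfl)
    · intro f hf
      refine Finset.mem_filter.2 ⟨Finset.mem_univ _, descSet_subset_iff_s8.2 fun i j hij hq => ?_⟩
      rw [← Composition.comp_sort_eq_index hf] at hq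
      exact (Tuple.eq_sort_iff.1 (rfl : Tuple.sort f = Tuple.sort f)).2 i j hij hq
    · exact fun σ _ => Composition.comp_perm_mem_blockMaps q.index_mem_blockMaps _
    · intro f hf
      rw [← Composition.comp_sort_eq_index hf]
      ext
      simp
    · exact fun σ hσ => hsort σ (Finset.mem_filter.1 hσ).2

theorem exists_actsAs {b : GroupAlg n p} (hb : b ∈ descentAlgebra n p) : ∃ a, ActsAs a b := by
  induction hb using Algebra.adjoin_induction with
  | mem x hx =>
    obtain ⟨q, rfl⟩ := hx
    exact ⟨_, actsAs_orbitSum q⟩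
  | algebraMap c =>
    rw [Algebra.algebraMap_eq_smul_one]
    exact ⟨_, ActsAs.one.smul c⟩
  | add x y _ _ hx hy =>
    obtain ⟨a, ha⟩ := hx
    obtain ⟨a', ha'⟩ := hy
    exact ⟨_, ha.add ha'⟩
  | mul x y _ _ hx hy =>
    obtain ⟨a, ha⟩ := hx
    obtain ⟨a', ha'⟩ := hy
    exact ⟨_, ha'.mul ha⟩

theorem mem_descentRadicalSubmodule {a : MonoidAlgebra (ZMod p) (LexRel (Fin n))}
    {b : GroupAlg n p} (hb : b ∈ descentAlgebra n p) (hab : ActsAs a b)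
    (ha : ∀ e, supportChar (ZMod p) e a = 0) : b ∈ descentRadicalSubmodule n p := by
  refine ⟨⟨b, hb⟩, ?_, rfl⟩
  refine Ideal.mem_jacobson_iff.2 fun y => ?_
  obtain ⟨a', ha'⟩ := exists_actsAs y.2
  have hnil : IsNilpotent (y.1 * b) :=
    (hab.mul ha').isNilpotent (isNilpotent_of_supportChar_eq_zero fun e => by
      rw [map_mul, ha e, zero_mul])
  have hnil' : IsNilpotent (y * ⟨b, hb⟩) := by
    obtain ⟨m, hm⟩ := hnil
    exact ⟨m, Subtype.ext hm⟩
  obtain ⟨u, hu⟩ := hnil'.isUnit_one_add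
  refine ⟨↑u⁻¹, ?_⟩
  have h1 : (↑u⁻¹ : descentAlgebra n p) * (1 + y * ⟨b, hb⟩) = 1 := by rw [← hu, Units.inv_mul]
  rw [Ideal.mem_bot, sub_eq_zero, ← h1, mul_add, mul_one, mul_assoc, add_comm]

theorem coeff_Bel (q : Composition n) (σ : Equiv.Perm (Fin n)) :
    (Bel n p q).coeff σ = if descSet σ ⊆ properPartialSums q then 1 else 0 := by
  simp [Bel, MonoidAlgebra.coeff_sum, Finsupp.single_apply]

theorem linearIndependent_Bel : LinearIndependent (ZMod p) (Bel n p) := by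
  rw [Fintype.linearIndependent_iff]
  intro c hc
  suffices h : ∀ m, ∀ q : Composition n, n + 1 ≤ q.boundaries.card + m → c q = 0 from
    fun q => h (n + 1) q (Nat.le_add_left _ _)
  intro m
  induction m using Nat.strong_induction_on with
  | _ m ih =>
    intro q hq
    obtain ⟨σ, hσ⟩ := exists_descSet_eq q
    have h0 : ∑ r, c r * (Bel n p r).coeff σ = 0 := by
      have := congrArg (fun a : GroupAlg n p => a.coeff σ) hc
      simpa [MonoidAlgebra.coeff_sum] using this
    rw [Finset.sum_eq_single q] at h0
    · simpa [coeff_Bel, hσ] using h0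
    · intro r _ hrq
      rw [coeff_Bel, hσ]
      split_ifs with hs
      · have hsub := Composition.boundaries_subset_of_properPartialSums_subset hs
        have hlt : q.boundaries.card < r.boundaries.card :=
          Finset.card_lt_card (hsub.ssubset_of_ne
            fun h => hrq (Composition.boundaries_injective h.symm))
        have hle : r.boundaries.card ≤ n + 1 := by simpa using Finset.card_le_univ r.boundaries
        rw [ih (m - 1) (by omega) r (by omega), zero_mul]
      · rw [mul_zero]
    · simp

theorem supportChar_orbitSum (q : Composition n) (e : Set (Fin n × Fin n)) :
    supportChar (ZMod p) e (orbitSum p q) =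
      ((q.blockMaps.filter fun f => ∀ x y, (x, y) ∈ e → f x = f y).card : ZMod p) := by
  simp only [orbitSum, map_sum, supportChar_single, subset_support_ofMap, Finset.sum_boole]

/-- The mod-`p` Young characters evaluated at the `p`-regular cycle types. -/
def youngEval (n p : ℕ) : (Composition n → ZMod p) →ₗ[ZMod p]
    ({π : n.Partition // ∀ i ∈ π.parts, ¬ p ∣ i} → ZMod p) :=
  Fintype.linearCombination (ZMod p) fun q π => youngCoeff p q π.1.parts

theorem linearCombination_Bel_mem_descentRadicalSubmodule [Fact p.Prime]
    {c : Composition n → ZMod p} (hc : youngEval n p c = 0) :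
    Fintype.linearCombination (ZMod p) (Bel n p) c ∈ descentRadicalSubmodule n p := by
  rw [Fintype.linearCombination_apply]
  have hacts : ∀ s : Finset (Composition n),
      ActsAs (∑ q ∈ s, c q • orbitSum p q) (∑ q ∈ s, c q • Bel n p q) := by
    intro s
    induction s using Finset.induction_on with
    | empty => simpa using ActsAs.zero
    | insert q s hq ih =>
      rw [Finset.sum_insert hq, Finset.sum_insert hq]
      exact ((actsAs_orbitSum q).smul (c q)).add ih
  refine mem_descentRadicalSubmodule (sum_mem fun q _ => Subalgebra.smul_mem _
    (BelS n p q).2 _) (hacts Finset.univ) fun e => ?_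
  obtain ⟨π, hπ, h⟩ := exists_regular_partition_youngCoeff_eq (p := p) fun x y => (x, y) ∈ e
  have := congrFun hc ⟨π, hπ⟩
  simpa [youngEval, Fintype.linearCombination_apply, supportChar_orbitSum, h] using this

end DescentAlgebra

/-- `dim_{F_p} R(n,p) ≥ 2^{n-1} - g(n,p)`, where `g(n,p)` is the number of
partitions of `n` having no part divisible by `p`. -/
theorem stmt8 (n p : ℕ) (hn : 1 ≤ n) (hp : p.Prime) :
    2 ^ (n - 1) - gPart n p ≤ Module.finrank (ZMod p) (descentRadicalSubmodule n p) := by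
  have : Fact p.Prime := ⟨hp⟩
  have hrank := (youngEval n p).finrank_range_add_finrank_ker
  rw [Module.finrank_pi, composition_card] at hrank
  have hrange : Module.finrank (ZMod p) (LinearMap.range (youngEval n p)) ≤ gPart n p := by
    refine (Submodule.finrank_le _).trans (le_of_eq ?_)
    rw [Module.finrank_pi, gPart, ← Nat.card_coe_set_eq, Nat.card_eq_fintype_card]
    rfl
  have hinj : Function.Injective (Fintype.linearCombination (ZMod p) (Bel n p)) :=
    linearIndependent_Bel.fintypeLinearCombination_injective
  have hker : Module.finrank (ZMod p) (LinearMap.ker (youngEval n p)) ≤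
      Module.finrank (ZMod p) (descentRadicalSubmodule n p) := by
    rw [(Submodule.equivMapOfInjective _ hinj _).finrank_eq]
    refine Submodule.finrank_mono ?_
    rintro _ ⟨c, hc, rfl⟩
    exact linearCombination_Bel_mem_descentRadicalSubmodule hc
  omega

end
end
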